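/- arXiv:1405.4746 — 12 statements merged into one kernel-verified Lean document; each statement's English description precedes it below -/
import Mathlib

section
/- Let 0 < α < 2 and define g : ℝ → ℝ by g(x) = 1/(1+|x|^{1+α}). Then there exists a constant C > 0 such that for every x ∈ ℝ the function h ↦ (g(x+h) + g(x−h) − 2 g(x)) / h^{1+α} is integrable on (0,∞) and |∫₀^∞ (g(x+h) + g(x−h) − 2 g(x)) h^{−1−α} dh| ≤ C g(x). -/
open MeasureTheory Set

lemma aux_four (p : ℝ) (hp : 1 < p) (b : ℝ) : (2 + |b|) ^ p ≤ 4 ^ p * (1 + |b| ^ p) := by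
  have h0 := abs_nonneg b
  have h4 : (0:ℝ) ≤ 4 ^ p := by positivity
  have hb : 0 ≤ |b| ^ p := by positivity
  rcases le_total |b| 2 with h | h
  · have : (2 + |b|) ^ p ≤ 4 ^ p := Real.rpow_le_rpow (by positivity) (by linarith) (by linarith)
    nlinarith
  · have : (2 + |b|) ^ p ≤ (4 * |b|) ^ p :=
      Real.rpow_le_rpow (by positivity) (by linarith) (by linarith)
    rw [Real.mul_rpow (by norm_num) h0] at this
    nlinarith

lemma aux_pow (p s : ℝ) (hp : 1 < p) (hs0 : 0 ≤ s) (hs : s ≤ p) (a b : ℝ) (hab : |a - b| ≤ 2) :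
    |a| ^ s ≤ 4 ^ p * (1 + |b| ^ p) := by
  have h0 := abs_nonneg b
  have : |a| ≤ 2 + |b| := by
    have := abs_sub_abs_le_abs_sub a b
    linarith
  calc |a| ^ s ≤ (2 + |b|) ^ s := Real.rpow_le_rpow (abs_nonneg _) this hs0
    _ ≤ (2 + |b|) ^ p := Real.rpow_le_rpow_of_exponent_le (by linarith) hs
    _ ≤ _ := aux_four p hp b

lemma aux_bern (p : ℝ) (hp : 1 < p) (A B : ℝ) (hB : 0 ≤ B) (hAB : B ≤ A) :
    A ^ p - B ^ p ≤ p * (A - B) * A ^ (p - 1) := by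
  rcases eq_or_lt_of_le (hB.trans hAB) with h | hA
  · have : B = 0 := by linarith
    subst this
    subst h
    simp
  have h1 := one_add_mul_self_le_rpow_one_add (s := B / A - 1) (p := p)
    (by have : 0 ≤ B / A := by positivity
        linarith) hp.le
  have h2 : 1 + (B / A - 1) = B / A := by ring
  rw [h2, Real.div_rpow hB hA.le, le_div_iff₀ (by positivity)] at h1
  have h3 : A ^ p = A ^ (p - 1) * A := by
    rw [← Real.rpow_add_one hA.ne']; ring_nf
  have h4 : (1 + p * (B / A - 1)) * A ^ p = A ^ p + p * (B - A) * A ^ (p - 1) := by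
    rw [h3]; field_simp
  rw [h4] at h1
  linarith

lemma aux_first (p : ℝ) (hp : 1 < p) (hp3 : p < 3) (a b : ℝ) (hab : |a - b| ≤ 2) :
    |(1 + |a| ^ p) - (1 + |b| ^ p)| ≤ 3 * 4 ^ p * |a - b| * (1 + |b| ^ p) := by
  have ha := aux_pow p (p - 1) hp (by linarith) (by linarith) a b hab
  have hb := aux_pow p (p - 1) hp (by linarith) (by linarith) b b (by simp)
  have key : ∀ A B : ℝ, 0 ≤ B → B ≤ A → A - B ≤ |a - b| →
      A ^ (p - 1) ≤ 4 ^ p * (1 + |b| ^ p) →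
      |A ^ p - B ^ p| ≤ 3 * 4 ^ p * |a - b| * (1 + |b| ^ p) := by
    intro A B hB hAB hd hA
    rw [abs_of_nonneg (sub_nonneg.2 (Real.rpow_le_rpow hB hAB (by linarith)))]
    have h0 : 0 ≤ A := hB.trans hAB
    calc _ ≤ _ := aux_bern p hp A B hB hAB
      _ ≤ 3 * |a - b| * (4 ^ p * (1 + |b| ^ p)) := by
        have : 0 ≤ A - B := by linarith
        gcongr
      _ = _ := by ring
  rw [add_sub_add_left_eq_sub]
  rcases le_total |b| |a| with h | h
  · exact key _ _ (abs_nonneg _) h (abs_sub_abs_le_abs_sub a b) ha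
  · rw [abs_sub_comm]
    refine key _ _ (abs_nonneg _) h ?_ hb
    rw [abs_sub_comm a b]
    exact abs_sub_abs_le_abs_sub b a

lemma aux_t (t : ℝ) (ht0 : 0 ≤ t) (ht1 : t ≤ 1) (A B : ℝ) (hB : 0 ≤ B) (hAB : B ≤ A) :
    B * A ^ t ≤ B ^ t * A := by
  rcases eq_or_lt_of_le hB with h | h
  · rw [← h, zero_mul]
    have : 0 ≤ A := hB.trans hAB
    positivity
  have hA : 0 < A := h.trans_le hAB
  have e : ∀ C : ℝ, 0 < C → C = C ^ t * C ^ (1 - t) := by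
    intro C hC
    rw [← Real.rpow_add hC]; simp
  have h1 : B ^ (1 - t) ≤ A ^ (1 - t) := Real.rpow_le_rpow hB hAB (by linarith)
  calc B * A ^ t = (B ^ t * B ^ (1 - t)) * A ^ t := by rw [← e B h]
    _ ≤ (B ^ t * A ^ (1 - t)) * A ^ t := by gcongr
    _ = B ^ t * (A ^ t * A ^ (1 - t)) := by ring
    _ = _ := by rw [← e A hA]

lemma aux_t2 (t : ℝ) (ht0 : 0 ≤ t) (ht1 : t ≤ 1) (A B : ℝ) (hA : 0 ≤ A) (hB : 0 ≤ B) :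
    |A ^ t - B ^ t| * B ≤ |A - B| * (A ^ t + B ^ t) := by
  have pA : 0 ≤ A ^ t := by positivity
  have pB : 0 ≤ B ^ t := by positivity
  rcases le_total B A with h | h
  · have := aux_t t ht0 ht1 A B hB h
    have h2 : B ^ t ≤ A ^ t := Real.rpow_le_rpow hB h ht0
    rw [abs_of_nonneg (by linarith), abs_of_nonneg (by linarith)]
    nlinarith
  · have := aux_t t ht0 ht1 B A hA h
    have h2 : A ^ t ≤ B ^ t := Real.rpow_le_rpow hA h ht0
    rw [abs_of_nonpos (by linarith), abs_of_nonpos (by linarith)]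
    nlinarith

lemma aux_deriv (t : ℝ) (ht0 : 0 ≤ t) (ht1 : t ≤ 1) (a b : ℝ) :
    |(|a| ^ t * a - |b| ^ t * b)| ≤ |a - b| * (2 * |a| ^ t + |b| ^ t) := by
  have h := aux_t2 t ht0 ht1 |a| |b| (abs_nonneg _) (abs_nonneg _)
  have e : |a| ^ t * a - |b| ^ t * b = |a| ^ t * (a - b) + (|a| ^ t - |b| ^ t) * b := by ring
  have pA : 0 ≤ |a| ^ t := by positivity
  have pB : 0 ≤ |b| ^ t := by positivity
  rw [e]
  refine (abs_add_le _ _).trans ?_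
  rw [abs_mul, abs_mul, abs_of_nonneg pA]
  have := abs_abs_sub_abs_le_abs_sub a b
  nlinarith

lemma aux_second_lo (p : ℝ) (hp : 1 < p) (hp2 : p ≤ 2) (x h : ℝ) (h0 : 0 < h) :
    |(|x + h| ^ p + |x - h| ^ p - 2 * |x| ^ p)| ≤ 2 * h ^ p := by
  have lo : 2 * |x| ^ p ≤ |x + h| ^ p + |x - h| ^ p := by
    have h1 := (convexOn_rpow hp.le).2 (mem_Ici.2 (abs_nonneg (x + h)))
      (mem_Ici.2 (abs_nonneg (x - h))) (by norm_num : (0:ℝ) ≤ 1/2) (by norm_num : (0:ℝ) ≤ 1/2)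
      (by norm_num)
    simp only [smul_eq_mul] at h1
    have h2 : |x| ≤ 1/2 * |x + h| + 1/2 * |x - h| := by
      have := abs_add_le (x + h) (x - h)
      have e : x + h + (x - h) = 2 * x := by ring
      rw [e, abs_mul] at this
      norm_num at this
      linarith
    have h3 := Real.rpow_le_rpow (abs_nonneg _) h2 (by linarith : (0:ℝ) ≤ p)
    linarith
  have hi : |x + h| ^ p + |x - h| ^ p ≤ 2 * |x| ^ p + 2 * h ^ p := by
    have e : ∀ y : ℝ, |y| ^ p = (y ^ 2) ^ (p / 2) := by
      intro y
      rw [← sq_abs, ← Real.rpow_natCast, ← Real.rpow_mul (abs_nonneg _)]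
      congr 1; push_cast; ring
    have c := (Real.concaveOn_rpow (p := p / 2) (by linarith) (by linarith)).2
      (mem_Ici.2 (sq_nonneg (x + h))) (mem_Ici.2 (sq_nonneg (x - h)))
      (by norm_num : (0:ℝ) ≤ 1/2) (by norm_num : (0:ℝ) ≤ 1/2) (by norm_num)
    have s := Real.rpow_add_le_add_rpow (sq_nonneg x) (sq_nonneg h)
      (by linarith : 0 ≤ p / 2) (by linarith)
    have e2 : h ^ p = (h ^ 2) ^ (p / 2) := by rw [← e, abs_of_pos h0]
    simp only [smul_eq_mul] at c
    have e3 : 1 / 2 * (x + h) ^ 2 + 1 / 2 * (x - h) ^ 2 = x ^ 2 + h ^ 2 := by ring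
    rw [e3] at c
    rw [e, e, e, e2]
    linarith
  rw [abs_of_nonneg (by linarith)]
  linarith

lemma aux_second_hi (p : ℝ) (hp : 2 ≤ p) (hp3 : p < 3) (x h : ℝ) (h0 : 0 < h) (h1 : h ≤ 1) :
    |(|x + h| ^ p + |x - h| ^ p - 2 * |x| ^ p)| ≤ 18 * 4 ^ p * h ^ 2 * (1 + |x + h| ^ p) := by
  have hd : ∀ s : ℝ, HasDerivAt (fun s => |x + s| ^ p + |x - s| ^ p)
      (p * |x + s| ^ (p - 2) * (x + s) * 1 + p * |x - s| ^ (p - 2) * (x - s) * (-1)) s := by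
    intro s
    have d1 : HasDerivAt (fun s => x + s) 1 s := (hasDerivAt_id s).const_add x
    have d2 : HasDerivAt (fun s => x - s) (-1) s := (hasDerivAt_id s).const_sub x
    exact ((hasDerivAt_abs_rpow (x + s) (by linarith : 1 < p)).comp s d1).add
      ((hasDerivAt_abs_rpow (x - s) (by linarith : 1 < p)).comp s d2)
  obtain ⟨ξ, hξ, he⟩ := exists_hasDerivAt_eq_slope _ _ h0
    (fun s _ => (hd s).continuousAt.continuousWithinAt) (fun s _ => hd s)
  obtain ⟨hξ0, hξ1⟩ := hξ
  have e1 : |x + h| ^ p + |x - h| ^ p - 2 * |x| ^ p =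
      h * (p * (|x + ξ| ^ (p - 2) * (x + ξ) - |x - ξ| ^ (p - 2) * (x - ξ))) := by
    rw [eq_div_iff (by linarith)] at he
    simp only [add_zero, sub_zero] at he
    linarith
  have b := aux_deriv (p - 2) (by linarith) (by linarith) (x + ξ) (x - ξ)
  have e2 : x + ξ - (x - ξ) = 2 * ξ := by ring
  rw [e2, abs_of_pos (by linarith : 0 < 2 * ξ)] at b
  have p1 := aux_pow p (p - 2) (by linarith) (by linarith) (by linarith) (x + ξ) (x + h)
    (by rw [abs_le]; constructor <;> linarith)
  have p2 := aux_pow p (p - 2) (by linarith) (by linarith) (by linarith) (x - ξ) (x + h)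
    (by rw [abs_le]; constructor <;> linarith)
  set M := 4 ^ p * (1 + |x + h| ^ p) with hM
  have hM0 : 0 ≤ M := by positivity
  rw [e1, abs_mul, abs_mul, abs_of_pos h0, abs_of_pos (by linarith : 0 < p)]
  calc _ ≤ h * (3 * (2 * h * (2 * M + M))) := by
        gcongr
        refine b.trans ?_
        gcongr
    _ = _ := by rw [hM]; ring

lemma aux_second (p : ℝ) (hp : 1 < p) (hp3 : p < 3) :
    ∃ q K : ℝ, q ≤ 2 ∧ -1 < q - p ∧ 0 < K ∧ ∀ x h : ℝ, 0 < h → h ≤ 1 →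
    |(|x + h| ^ p + |x - h| ^ p - 2 * |x| ^ p)| ≤ K * h ^ q * (1 + |x + h| ^ p) := by
  rcases le_total p 2 with h2 | h2
  · refine ⟨p, 2, h2, by linarith, by norm_num, fun x h h0 h1 => ?_⟩
    refine (aux_second_lo p hp h2 x h h0).trans ?_
    have : 0 ≤ h ^ p := by positivity
    have : 0 ≤ |x + h| ^ p := by positivity
    nlinarith [mul_nonneg ‹0 ≤ h ^ p› this]
  · refine ⟨2, 18 * 4 ^ p, le_rfl, by linarith, by positivity, fun x h h0 h1 => ?_⟩
    have := aux_second_hi p h2 hp3 x h h0 h1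
    rwa [Real.rpow_two]

lemma aux_small (p : ℝ) (hp : 1 < p) (hp3 : p < 3) (g : ℝ → ℝ)
    (hg : ∀ x, g x = 1 / (1 + |x| ^ p)) :
    ∃ q C : ℝ, -1 < q - p ∧ 0 < C ∧ ∀ x h : ℝ, 0 < h → h ≤ 1 →
    |g (x + h) + g (x - h) - 2 * g x| ≤ g x * (C * h ^ q) := by
  obtain ⟨q, K, hq2, hqp, hK, H⟩ := aux_second p hp hp3
  set L : ℝ := 3 * 4 ^ p with hL
  have hL0 : 0 < L := by positivity
  refine ⟨q, K + 2 * L ^ 2, hqp, by positivity, fun x h h0 h1 => ?_⟩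
  have H1 := H x h h0 h1
  have H2 := aux_first p hp hp3 x (x - h) (by rw [abs_le]; constructor <;> linarith)
  have H3 := aux_first p hp hp3 (x - h) (x + h) (by rw [abs_le]; constructor <;> linarith)
  rw [← hL] at H2 H3
  have e2 : x - (x - h) = h := by ring
  have e3 : x - h - (x + h) = - (2 * h) := by ring
  rw [e2, abs_of_pos h0] at H2
  rw [e3, abs_neg, abs_of_pos (by linarith : 0 < 2 * h)] at H3
  have hh : h ^ 2 ≤ h ^ q := by
    rw [← Real.rpow_two]
    exact Real.rpow_le_rpow_of_exponent_ge h0 h1 hq2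
  rw [hg, hg, hg]
  have E1 : |x + h| ^ p + |x - h| ^ p - 2 * |x| ^ p =
    (1 + |x + h| ^ p) + (1 + |x - h| ^ p) - 2 * (1 + |x| ^ p) := by ring
  rw [E1] at H1
  have ha : 0 < 1 + |x + h| ^ p := by positivity
  have hb : 0 < 1 + |x - h| ^ p := by positivity
  have hu : 0 < 1 + |x| ^ p := by positivity
  generalize 1 + |x + h| ^ p = a at *
  generalize 1 + |x - h| ^ p = b at *
  generalize 1 + |x| ^ p = u at *
  have E : 1 / a + 1 / b - 2 * (1 / u) = 1 / u * (-((a + b - 2 * u) / a)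
      + ((u - b) / b) * (-((b - a) / a))) := by
    field_simp; ring
  rw [E, abs_mul, abs_of_pos (by positivity : 0 < 1 / u)]
  gcongr
  refine (abs_add_le _ _).trans ?_
  rw [abs_neg, abs_mul, abs_neg, abs_div, abs_div, abs_div, abs_of_pos ha, abs_of_pos hb]
  have r1 : |a + b - 2 * u| / a ≤ K * h ^ q := by rwa [div_le_iff₀ ha]
  have r2 : |u - b| / b ≤ L * h := by rwa [div_le_iff₀ hb]
  have r3 : |b - a| / a ≤ L * (2 * h) := by rwa [div_le_iff₀ ha]
  calc _ ≤ K * h ^ q + (L * h) * (L * (2 * h)) := by gcongr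
    _ = K * h ^ q + 2 * L ^ 2 * h ^ 2 := by ring
    _ ≤ K * h ^ q + 2 * L ^ 2 * h ^ q := by gcongr
    _ = _ := by ring

lemma aux_conv (p : ℝ) (hp : 1 < p) (g : ℝ → ℝ)
    (hg : ∀ x, g x = 1 / (1 + |x| ^ p)) (a b : ℝ) :
    g a * g b ≤ 2 ^ p * g (a + b) * (g a + g b) := by
  have key : 1 + |a + b| ^ p ≤ 2 ^ p * ((1 + |a| ^ p) + (1 + |b| ^ p)) := by
    have c : ∀ A B : ℝ, |A| ≤ |B| → |A + B| ^ p ≤ 2 ^ p * |B| ^ p := by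
      intro A B h
      rw [← Real.mul_rpow (by norm_num) (abs_nonneg _)]
      refine Real.rpow_le_rpow (abs_nonneg _) ?_ (by linarith)
      have := abs_add_le A B
      linarith
    have h2 : (1:ℝ) ≤ 2 ^ p := Real.one_le_rpow (by norm_num) (by linarith)
    have pA : 0 ≤ |a| ^ p := by positivity
    have pB : 0 ≤ |b| ^ p := by positivity
    rcases le_total |a| |b| with h | h
    · have := c a b h
      nlinarith
    · have := c b a h
      rw [add_comm b a] at this
      nlinarith
  rw [hg, hg, hg]
  have ha : 0 < 1 + |a| ^ p := by positivity
  have hb : 0 < 1 + |b| ^ p := by positivity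
  have hu : 0 < 1 + |a + b| ^ p := by positivity
  generalize 1 + |a| ^ p = A at *
  generalize 1 + |b| ^ p = B at *
  generalize 1 + |a + b| ^ p = u at *
  have : 2 ^ p * (1 / u) * (1 / A + 1 / B) = (1 / A * (1 / B)) * (2 ^ p * (A + B) / u) := by
    field_simp; ring
  rw [this]
  refine le_mul_of_one_le_right (by positivity) ?_
  rwa [one_le_div hu]

lemma aux_large (p : ℝ) (hp : 1 < p) (g : ℝ → ℝ)
    (hg : ∀ x, g x = 1 / (1 + |x| ^ p)) (x h : ℝ) (h1 : 1 ≤ h) :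
    |g (x + h) + g (x - h) - 2 * g x| / h ^ p ≤
      g x * (8 * 2 ^ p * (g (x + h) + g (x - h) + g h)) := by
  have g0 : ∀ y, 0 < g y := fun y => by rw [hg]; positivity
  have geven : g (-h) = g h := by rw [hg, hg, abs_neg]
  have c1 := aux_conv p hp g hg (x + h) (-h)
  have c2 := aux_conv p hp g hg (x - h) h
  rw [geven, add_neg_cancel_right] at c1
  rw [sub_add_cancel] at c2
  have hp1 : 1 ≤ h ^ p := Real.one_le_rpow h1 (by linarith)
  have hh : 1 / h ^ p ≤ 2 * g h := by
    rw [hg, abs_of_pos (by linarith), mul_one_div, div_le_div_iff₀ (by linarith) (by linarith)]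
    linarith
  have h2 : (1:ℝ) ≤ 2 ^ p := Real.one_le_rpow (by norm_num) (by linarith)
  have A : |g (x + h) + g (x - h) - 2 * g x| ≤ g (x + h) + g (x - h) + 2 * g x := by
    have := g0 (x + h); have := g0 (x - h); have := g0 x
    rw [abs_le]; constructor <;> linarith
  have p1 := g0 (x + h)
  have p2 := g0 (x - h)
  have p3 := g0 x
  have p4 := g0 h
  rw [div_eq_mul_one_div]
  calc _ ≤ (g (x + h) + g (x - h) + 2 * g x) * (2 * g h) := by gcongr
    _ = 2 * (g (x + h) * g h) + 2 * (g (x - h) * g h) + 4 * 1 * (g x * g h) := by ring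
    _ ≤ 2 * (2 ^ p * g x * (g (x + h) + g h)) + 2 * (2 ^ p * g x * (g (x - h) + g h))
        + 4 * 2 ^ p * (g x * g h) := by gcongr
    _ ≤ _ := by
      have : 0 ≤ 2 ^ p * g x * g (x + h) := by positivity
      have : 0 ≤ 2 ^ p * g x * g (x - h) := by positivity
      nlinarith

lemma aux_int (p : ℝ) (hp : 1 < p) (g : ℝ → ℝ) (hc : Continuous g)
    (hg : ∀ x, g x = 1 / (1 + |x| ^ p)) : Integrable g := by
  have h1 : Integrable (fun x : ℝ => (1 + ‖x‖) ^ (-p)) :=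
    integrable_one_add_norm (by simpa using hp)
  refine (h1.const_mul (4 ^ p)).mono' hc.aestronglyMeasurable (Filter.Eventually.of_forall ?_)
  intro x
  have g0 : 0 < g x := by rw [hg]; positivity
  have h0 := abs_nonneg x
  rw [Real.norm_of_nonneg g0.le, hg, Real.norm_eq_abs, Real.rpow_neg (by positivity),
    ← div_eq_mul_inv, div_le_div_iff₀ (by positivity) (by positivity), one_mul]
  refine le_trans ?_ (aux_four p hp x)
  exact Real.rpow_le_rpow (by positivity) (by linarith) (by linarith)

/-- For `0 < α < 2` and `g x = 1/(1+|x|^(1+α))`, the fractional Laplacian of `g` is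
bounded by a constant multiple of `g`: there is `C > 0` such that for all `x`,
the integrand of `(-Δ)^(α/2) g (x)` is integrable on `(0,∞)` and
`|∫₀^∞ (g(x+h)+g(x-h)-2g(x)) h^(-1-α) dh| ≤ C g(x)`. -/
theorem stmt0 (α : ℝ) (hα0 : 0 < α) (hα2 : α < 2)
    (g : ℝ → ℝ) (hg : ∀ x, g x = 1 / (1 + |x| ^ (1 + α))) :
    ∃ C > 0, ∀ x : ℝ,
      IntegrableOn (fun h : ℝ => (g (x + h) + g (x - h) - 2 * g x) / h ^ (1 + α))
        (Ioi 0) volume ∧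
      |∫ h in Ioi (0 : ℝ), (g (x + h) + g (x - h) - 2 * g x) / h ^ (1 + α)| ≤ C * g x := by
  have hp : 1 < 1 + α := by linarith
  have hp3 : 1 + α < 3 := by linarith
  generalize 1 + α = p at *
  have hc : Continuous g := by
    have : g = fun x => 1 / (1 + |x| ^ p) := funext hg
    rw [this]
    refine continuous_const.div (continuous_const.add
      (continuous_abs.rpow_const (fun x => Or.inr (by linarith)))) (fun x => ?_)
    positivity
  have gi := aux_int p hp g hc hg
  have g0 : ∀ y, 0 < g y := fun y => by rw [hg]; positivity
  obtain ⟨q, C, hqp, hC, H⟩ := aux_small p hp hp3 g hg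
  let k : ℝ → ℝ := (Ioc (0:ℝ) 1).indicator (fun h => C * h ^ (q - p))
  have k0 : ∀ h, 0 ≤ k h := by
    intro h
    refine indicator_nonneg (fun y hy => ?_) h
    have := hy.1
    positivity
  have ki : Integrable k := by
    have : IntegrableOn (fun h : ℝ => C * h ^ (q - p)) (Ioc 0 1) := by
      have := (intervalIntegral.intervalIntegrable_rpow' (a := 0) (b := 1) hqp).const_mul C
      rwa [intervalIntegrable_iff_integrableOn_Ioc_of_le zero_le_one] at this
    exact this.integrable_indicator measurableSet_Ioc
  let B : ℝ := 8 * 2 ^ p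
  have B0 : 0 < B := by positivity
  let F : ℝ → ℝ → ℝ := fun x h => g x * (k h + B * (g (x + h) + g (x - h) + g h))
  have i1 : ∀ x, Integrable (fun h => g (x + h)) := fun x => gi.comp_add_left x
  have i2 : ∀ x, Integrable (fun h => g (x - h)) := fun x => gi.comp_sub_left x
  have Fi : ∀ x, Integrable (F x) := fun x =>
    (ki.add ((((i1 x).add (i2 x)).add gi).const_mul B)).const_mul (g x)
  have F0 : ∀ x h, 0 ≤ F x h := by
    intro x h
    have := k0 h; have := g0 x; have := g0 (x + h); have := g0 (x - h); have := g0 h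
    positivity
  have bd : ∀ x, ∀ h ∈ Ioi (0:ℝ), ‖(g (x + h) + g (x - h) - 2 * g x) / h ^ p‖ ≤ F x h := by
    intro x h hh
    have hh : 0 < h := hh
    have hhp : 0 < h ^ p := by positivity
    rw [Real.norm_eq_abs, abs_div, abs_of_pos hhp]
    have := k0 h; have := g0 x; have := g0 (x + h); have := g0 (x - h); have := g0 h
    rcases le_total h 1 with h1 | h1
    · have e : k h = C * h ^ (q - p) := indicator_of_mem (mem_Ioc.2 ⟨hh, h1⟩) _
      have : |g (x + h) + g (x - h) - 2 * g x| / h ^ p ≤ g x * k h := by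
        rw [e, Real.rpow_sub hh, div_le_iff₀ hhp]
        refine (H x h hh h1).trans (le_of_eq ?_)
        field_simp
      refine this.trans ?_
      change g x * k h ≤ g x * (k h + B * (g (x + h) + g (x - h) + g h))
      gcongr
      have : 0 ≤ B * (g (x + h) + g (x - h) + g h) := by positivity
      linarith
    · refine (aux_large p hp g hg x h h1).trans ?_
      change g x * (B * (g (x + h) + g (x - h) + g h))
        ≤ g x * (k h + B * (g (x + h) + g (x - h) + g h))
      gcongr
      linarith
  have G0 : 0 ≤ ∫ y, g y := integral_nonneg (fun y => (g0 y).le)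
  have K0 : 0 ≤ ∫ y, k y := integral_nonneg k0
  refine ⟨(∫ y, k y) + 3 * B * (∫ y, g y) + 1, by positivity, fun x => ⟨?_, ?_⟩⟩
  · refine (Fi x).integrableOn.mono' ?_ ((ae_restrict_iff' measurableSet_Ioi).2
      (Filter.Eventually.of_forall (bd x)))
    have m := hc.measurable
    refine Measurable.aestronglyMeasurable ?_
    fun_prop
  · rw [← Real.norm_eq_abs]
    have s1 := norm_integral_le_of_norm_le (Fi x).integrableOn
      ((ae_restrict_iff' measurableSet_Ioi).2 (Filter.Eventually.of_forall (bd x)))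
    refine s1.trans ((setIntegral_le_integral (Fi x)
      (Filter.Eventually.of_forall (F0 x))).trans ?_)
    have e : ∫ h, F x h = g x * ((∫ y, k y) + B * ((∫ y, g y) + (∫ y, g y) + ∫ y, g y)) := by
      have t1 : ∫ h, g (x + h) = ∫ y, g y := integral_add_left_eq_self g x
      have t2 : ∫ h, g (x - h) = ∫ y, g y := integral_sub_left_eq_self g volume x
      change ∫ h, g x * (k h + B * (g (x + h) + g (x - h) + g h)) = _
      have j1 : Integrable (fun h => g (x + h) + g (x - h)) := (i1 x).add (i2 x)
      have j2 : Integrable (fun h => g (x + h) + g (x - h) + g h) := j1.add gi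
      rw [integral_const_mul, integral_add ki (j2.const_mul B),
        integral_const_mul, integral_add j1 gi, integral_add (i1 x) (i2 x), t1, t2]
    rw [e]
    have := g0 x
    nlinarith
end

section
/- Let 0 < α < 2 and let p ∈ ℝ with |p| < α. Then the function k ↦ (e^{pk} + e^{−pk} − 2) e^k / (e^k − 1)^{1+α} is integrable on (0,∞); that is, the Hamiltonian H(p) = ∫₀^∞ (e^{pk} + e^{−pk} − 2) e^k (e^k − 1)^{−1−α} dk is finite. -/
open MeasureTheory Set

/-- For `0 < α < 2` and `|p| < α`, the integrand of the Hamiltonian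
`H(p) = ∫₀^∞ (e^{pk} + e^{-pk} - 2) e^k (e^k-1)^{-1-α} dk` is integrable on `(0,∞)`. -/
theorem stmt4 (α p : ℝ) (hα0 : 0 < α) (hα2 : α < 2) (hp : |p| < α) :
    IntegrableOn
      (fun k : ℝ => (Real.exp (p * k) + Real.exp (-p * k) - 2) * Real.exp k
        / (Real.exp k - 1) ^ (1 + α))
      (Ioi 0) volume := by
  have hmeas : Measurable (fun k : ℝ => (Real.exp (p * k) + Real.exp (-p * k) - 2) * Real.exp k
        / (Real.exp k - 1) ^ (1 + α)) := by fun_prop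
  have hcosh : ∀ k : ℝ, Real.exp (p * k) + Real.exp (-p * k) - 2 = 2 * (Real.cosh (p * k) - 1) := by
    intro k
    rw [Real.cosh_eq, neg_mul]; ring
  have hnum : ∀ k : ℝ, 0 ≤ Real.exp (p * k) + Real.exp (-p * k) - 2 := by
    intro k
    rw [hcosh]
    have := Real.one_le_cosh (p * k)
    linarith
  have hpos : ∀ k : ℝ, 0 < k → 0 < Real.exp k - 1 := by
    intro k hk
    have := Real.add_one_le_exp k
    linarith
  have hnn : ∀ k : ℝ, 0 < k → 0 ≤ (Real.exp (p * k) + Real.exp (-p * k) - 2) * Real.exp k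
        / (Real.exp k - 1) ^ (1 + α) := by
    intro k hk
    have h1 := hnum k
    have h2 := hpos k hk
    positivity
  rw [← Ioc_union_Ioi_eq_Ioi (zero_le_one (α := ℝ)), integrableOn_union]
  constructor
  · have hint : IntegrableOn (fun k : ℝ => (p ^ 2 * Real.exp (p ^ 2 / 2) * Real.exp 1) * k ^ (1 - α))
        (Ioc 0 1) volume := by
      have := intervalIntegral.intervalIntegrable_rpow' (a := 0) (b := 1) (r := 1 - α) (by linarith)
      rw [intervalIntegrable_iff_integrableOn_Ioc_of_le zero_le_one] at this
      exact this.const_mul _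
    refine Integrable.mono' hint hmeas.aestronglyMeasurable ?_
    refine (ae_restrict_iff' measurableSet_Ioc).2 (Filter.Eventually.of_forall ?_)
    rintro k ⟨hk0, hk1⟩
    rw [Real.norm_of_nonneg (hnn k hk0)]
    have h1 : Real.exp (p * k) + Real.exp (-p * k) - 2 ≤ p ^ 2 * Real.exp (p ^ 2 / 2) * k ^ 2 := by
      rw [hcosh]
      have a1 := Real.cosh_le_exp_half_sq (p * k)
      set y := (p * k) ^ 2 / 2 with hy
      have hy0 : 0 ≤ y := by positivity
      have a2 : Real.exp y - 1 ≤ y * Real.exp y := by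
        have b1 := Real.add_one_le_exp (-y)
        have b2 : Real.exp (-y) * Real.exp y = 1 := by rw [← Real.exp_add]; simp
        nlinarith [Real.exp_pos y]
      have a3 : Real.exp y ≤ Real.exp (p ^ 2 / 2) := by
        apply Real.exp_le_exp.2
        have : k ^ 2 ≤ 1 := by nlinarith
        rw [hy, mul_pow]
        nlinarith [sq_nonneg p]
      have a4 := mul_le_mul_of_nonneg_left a3 hy0
      calc 2 * (Real.cosh (p * k) - 1) ≤ 2 * (y * Real.exp (p ^ 2 / 2)) := by linarith
        _ = _ := by rw [hy]; ring
    have h2 : k ^ (1 + α) ≤ (Real.exp k - 1) ^ (1 + α) := by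
      apply Real.rpow_le_rpow hk0.le _ (by linarith)
      have := Real.add_one_le_exp k
      linarith
    have h3 : Real.exp k ≤ Real.exp 1 := Real.exp_le_exp.2 hk1
    have h4 : k ^ (1 - α) = k ^ 2 / k ^ (1 + α) := by
      rw [← Real.rpow_natCast, ← Real.rpow_sub hk0]
      congr 1; push_cast; ring
    have h5 : 0 < k ^ (1 + α) := Real.rpow_pos_of_pos hk0 _
    rw [h4]
    calc _ ≤ (p ^ 2 * Real.exp (p ^ 2 / 2) * k ^ 2) * Real.exp 1 / k ^ (1 + α) := by gcongr
      _ = _ := by ring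
  · set c : ℝ := 1 - Real.exp (-1) with hc
    have hc0 : 0 < c := by
      have : Real.exp (-1) < 1 := by simp
      linarith
    have hint : IntegrableOn (fun k : ℝ => (2 / c ^ (1 + α)) * Real.exp ((|p| - α) * k))
        (Ioi 1) volume := 
      (integrableOn_exp_mul_Ioi (by linarith) 1).const_mul _
    refine Integrable.mono' hint hmeas.aestronglyMeasurable ?_
    refine (ae_restrict_iff' measurableSet_Ioi).2 (Filter.Eventually.of_forall ?_)
    intro k hk
    have hk1 : 1 < k := hk
    have hk0 : 0 < k := by linarith
    rw [Real.norm_of_nonneg (hnn k hk0)]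
    have h1 : Real.exp (p * k) + Real.exp (-p * k) - 2 ≤ 2 * Real.exp (|p| * k) := by
      have a1 : Real.exp (p * k) ≤ Real.exp (|p| * k) :=
        Real.exp_le_exp.2 (mul_le_mul_of_nonneg_right (le_abs_self p) hk0.le)
      have a2 : Real.exp (-p * k) ≤ Real.exp (|p| * k) :=
        Real.exp_le_exp.2 (mul_le_mul_of_nonneg_right (neg_le_abs p) hk0.le)
      linarith
    have h2 : c ^ (1 + α) * Real.exp (k * (1 + α)) ≤ (Real.exp k - 1) ^ (1 + α) := by
      rw [Real.exp_mul, ← Real.mul_rpow hc0.le (Real.exp_pos k).le]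
      apply Real.rpow_le_rpow (by positivity) _ (by linarith)
      have : 1 ≤ Real.exp (-1) * Real.exp k := by
        rw [← Real.exp_add]; exact Real.one_le_exp (by linarith)
      rw [hc]; linarith
    have h5 : 0 < c ^ (1 + α) := Real.rpow_pos_of_pos hc0 _
    calc _ ≤ (2 * Real.exp (|p| * k)) * Real.exp k / (c ^ (1 + α) * Real.exp (k * (1 + α))) := by
          gcongr
      _ = _ := by
        have : Real.exp ((|p| - α) * k) * Real.exp (k * (1 + α)) = Real.exp (|p| * k) * Real.exp k := by
          rw [← Real.exp_add, ← Real.exp_add]; congr 1; ring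
        rw [mul_assoc, ← this]
        field_simp
end

section
/- Let 0 < A < α < 2 and define H(p) = ∫₀^∞ (e^{pk} + e^{−pk} − 2) e^k (e^k − 1)^{−1−α} dk. Set C̲ = ∫₀^∞ k² (e^{−Ak} + 1) e^k / (2 (e^k − 1)^{1+α}) dk and C̄ = ∫₀^∞ k² (e^{Ak} + 1) e^k / (2 (e^k − 1)^{1+α}) dk. Then 0 < C̲ ≤ C̄ < ∞, and for every p with |p| ≤ A one has C̲ p² ≤ H(p) ≤ C̄ p². -/
open MeasureTheory Set

lemma aux_sinh {y : ℝ} (hy : 0 ≤ y) : Real.sinh y ≤ y * Real.cosh y := by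
  have hm : MonotoneOn (fun y : ℝ => y * Real.cosh y - Real.sinh y) (Ici 0) := by
    have hd : ∀ x : ℝ, HasDerivAt (fun y : ℝ => y * Real.cosh y - Real.sinh y)
        (1 * Real.cosh x + x * Real.sinh x - Real.cosh x) x := fun x =>
      ((hasDerivAt_id x).mul (Real.hasDerivAt_cosh x)).sub (Real.hasDerivAt_sinh x)
    apply monotoneOn_of_deriv_nonneg (convex_Ici 0)
    · exact fun x _ => (hd x).continuousAt.continuousWithinAt
    · exact fun x _ => (hd x).differentiableAt.differentiableWithinAt
    · intro x hx
      rw [interior_Ici] at hx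
      rw [(hd x).deriv]
      have h1 : 0 ≤ Real.sinh x := Real.sinh_nonneg_iff.2 (le_of_lt hx)
      have h2 : 0 ≤ x * Real.sinh x := mul_nonneg (le_of_lt hx) h1
      linarith
  have h := hm (self_mem_Ici) (mem_Ici.2 hy) hy
  simp at h
  exact h

lemma aux_expr (x : ℝ) : Real.exp x + Real.exp (-x) - 2 = 4 * Real.sinh (x / 2) ^ 2 := by
  have h1 := Real.cosh_two_mul (x / 2)
  have h2 := Real.cosh_sq (x / 2)
  have h3 := Real.cosh_eq x
  rw [show 2 * (x / 2) = x by ring] at h1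
  linarith

lemma aux_lower (x : ℝ) : x ^ 2 ≤ Real.exp x + Real.exp (-x) - 2 := by
  rw [aux_expr]
  have h : |x / 2| ≤ |Real.sinh (x / 2)| := by
    rw [Real.abs_sinh]
    exact Real.self_le_sinh_iff.2 (abs_nonneg _)
  have := sq_le_sq.2 h
  linarith [this]

lemma aux_upper (x : ℝ) :
    Real.exp x + Real.exp (-x) - 2 ≤ x ^ 2 * (Real.exp |x| + 1) / 2 := by
  rw [aux_expr]
  have h := aux_sinh (abs_nonneg (x / 2))
  rw [← Real.abs_sinh, Real.cosh_abs] at h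
  have hsq : Real.sinh (x / 2) ^ 2 ≤ (x / 2) ^ 2 * Real.cosh (x / 2) ^ 2 := by
    have := pow_le_pow_left₀ (abs_nonneg _) h 2
    rwa [mul_pow, sq_abs, sq_abs] at this
  have h1 := Real.cosh_two_mul (x / 2)
  have h2 := Real.cosh_sq (x / 2)
  rw [show 2 * (x / 2) = x by ring] at h1
  have h4 : Real.cosh x ≤ Real.exp |x| := by
    rw [← Real.cosh_abs, Real.cosh_eq]
    have : Real.exp (-|x|) ≤ Real.exp |x| := Real.exp_le_exp.2 (by linarith [abs_nonneg x])
    linarith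
  have h5 : Real.cosh (x / 2) ^ 2 ≤ (Real.exp |x| + 1) / 2 := by linarith
  have h6 := mul_le_mul_of_nonneg_left h5 (sq_nonneg (x / 2))
  nlinarith

lemma aux_denom {α k : ℝ} (h0 : 0 < α) (hα2 : α < 2) (hk : 0 < k) :
    k ^ (1 + α) * Real.exp ((1 + α) * k) ≤ (1 + k) ^ 3 * (Real.exp k - 1) ^ (1 + α) := by
  have he : 0 < Real.exp k - 1 := by linarith [Real.add_one_lt_exp hk.ne']
  have h1 : k * Real.exp k ≤ (1 + k) * (Real.exp k - 1) := by
    linarith [Real.add_one_lt_exp hk.ne']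
  have h2 := Real.rpow_le_rpow (by positivity) h1 (by linarith : 0 ≤ 1 + α)
  rw [Real.mul_rpow hk.le (Real.exp_pos k).le, Real.mul_rpow (by linarith) he.le,
    ← Real.exp_mul, mul_comm k (1 + α)] at h2
  refine h2.trans ?_
  have h3 : (1 + k) ^ (1 + α) ≤ (1 + k) ^ (3 : ℝ) :=
    Real.rpow_le_rpow_of_exponent_le (by linarith) (by linarith)
  have h4 : (1 + k) ^ (3 : ℝ) = (1 + k) ^ 3 := by exact_mod_cast Real.rpow_natCast (1 + k) 3
  rw [h4] at h3
  exact mul_le_mul_of_nonneg_right h3 (Real.rpow_nonneg he.le _)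

lemma aux_gamma {b s : ℝ} (hb : 0 < b) (hs : -1 < s) :
    IntegrableOn (fun k : ℝ => k ^ s * Real.exp (-b * k)) (Ioi 0) volume := by
  simpa using integrableOn_rpow_mul_exp_neg_mul_rpow hs (zero_lt_one (α := ℝ)) hb

lemma aux_dom {α A : ℝ} (hAα : A < α) (hα2 : α < 2) :
    IntegrableOn (fun k : ℝ => (1 + k) ^ 3 * (k ^ (1 - α) * Real.exp (-(α - A) * k)))
      (Ioi 0) volume := by
  have hb : 0 < α - A := by linarith
  have i0 := aux_gamma hb (by linarith : -1 < 1 - α)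
  have i1 := aux_gamma hb (by linarith : -1 < 1 - α + 1)
  have i2 := aux_gamma hb (by linarith : -1 < 1 - α + 2)
  have i3 := aux_gamma hb (by linarith : -1 < 1 - α + 3)
  refine (((i0.add (i1.const_mul 3)).add (i2.const_mul 3)).add i3).congr_fun ?_ measurableSet_Ioi
  intro k hk
  have hk : 0 < k := hk
  have e2 : k ^ (2 : ℝ) = k ^ 2 := by exact_mod_cast Real.rpow_natCast k 2
  have e3 : k ^ (3 : ℝ) = k ^ 3 := by exact_mod_cast Real.rpow_natCast k 3
  simp only [Pi.add_apply, Real.rpow_add hk (1 - α), e2, e3, Real.rpow_one]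
  ring

lemma aux_int_s6 {α A : ℝ} (hA : 0 < A) (hAα : A < α) (hα2 : α < 2) :
    IntegrableOn
      (fun k : ℝ => k ^ 2 * (Real.exp (A * k) + 1) * Real.exp k
        / (2 * (Real.exp k - 1) ^ (1 + α))) (Ioi 0) volume := by
  refine (aux_dom hAα hα2).mono' (Measurable.aestronglyMeasurable (by fun_prop)) ?_
  refine (ae_restrict_mem measurableSet_Ioi).mono fun k hk => ?_
  have hk : 0 < k := hk
  have he : 0 < Real.exp k - 1 := by linarith [Real.add_one_lt_exp hk.ne']
  have hr : 0 < (Real.exp k - 1) ^ (1 + α) := Real.rpow_pos_of_pos he _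
  rw [Real.norm_of_nonneg (by positivity), div_le_iff₀ (by positivity)]
  have hd := aux_denom (hA.trans hAα) hα2 hk
  have h1 : 1 ≤ Real.exp (A * k) := Real.one_le_exp (by positivity)
  calc k ^ 2 * (Real.exp (A * k) + 1) * Real.exp k
      ≤ k ^ 2 * (2 * Real.exp (A * k)) * Real.exp k := by gcongr; linarith
    _ = 2 * (k ^ (1 - α) * Real.exp (-(α - A) * k)) *
        (k ^ (1 + α) * Real.exp ((1 + α) * k)) := by
      have e1 : k ^ (1 - α) * k ^ (1 + α) = k ^ 2 := by
        rw [← Real.rpow_add hk, show 1 - α + (1 + α) = ((2 : ℕ) : ℝ) by push_cast; ring,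
          Real.rpow_natCast]
      have e2 : Real.exp (-(α - A) * k) * Real.exp ((1 + α) * k)
          = Real.exp (A * k) * Real.exp k := by
        rw [← Real.exp_add, ← Real.exp_add]; congr 1; ring
      rw [← e1]
      linear_combination (-2 * k ^ (1 - α) * k ^ (1 + α)) * e2
    _ ≤ 2 * (k ^ (1 - α) * Real.exp (-(α - A) * k)) *
        ((1 + k) ^ 3 * (Real.exp k - 1) ^ (1 + α)) := by gcongr
    _ = _ := by ring

/-- For `0 < A < α < 2`, with
`H(p) = ∫₀^∞ (e^{pk} + e^{-pk} - 2) e^k (e^k-1)^{-1-α} dk`,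
`C̲ = ∫₀^∞ k²(e^{-Ak}+1)e^k/(2(e^k-1)^{1+α}) dk` and
`C̄ = ∫₀^∞ k²(e^{Ak}+1)e^k/(2(e^k-1)^{1+α}) dk`, one has `0 < C̲ ≤ C̄ < ∞`
(finiteness expressed as integrability of the defining integrands) and
`C̲ p² ≤ H(p) ≤ C̄ p²` for all `|p| ≤ A`. -/
theorem stmt6 (α A : ℝ) (hA : 0 < A) (hAα : A < α) (hα2 : α < 2) :
    IntegrableOn
      (fun k : ℝ => k ^ 2 * (Real.exp (-A * k) + 1) * Real.exp k
        / (2 * (Real.exp k - 1) ^ (1 + α))) (Ioi 0) volume ∧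
    IntegrableOn
      (fun k : ℝ => k ^ 2 * (Real.exp (A * k) + 1) * Real.exp k
        / (2 * (Real.exp k - 1) ^ (1 + α))) (Ioi 0) volume ∧
    0 < ∫ k in Ioi (0 : ℝ), k ^ 2 * (Real.exp (-A * k) + 1) * Real.exp k
        / (2 * (Real.exp k - 1) ^ (1 + α)) ∧
    (∫ k in Ioi (0 : ℝ), k ^ 2 * (Real.exp (-A * k) + 1) * Real.exp k
        / (2 * (Real.exp k - 1) ^ (1 + α)))
      ≤ ∫ k in Ioi (0 : ℝ), k ^ 2 * (Real.exp (A * k) + 1) * Real.exp k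
        / (2 * (Real.exp k - 1) ^ (1 + α)) ∧
    ∀ p : ℝ, |p| ≤ A →
      (∫ k in Ioi (0 : ℝ), k ^ 2 * (Real.exp (-A * k) + 1) * Real.exp k
          / (2 * (Real.exp k - 1) ^ (1 + α))) * p ^ 2
        ≤ (∫ k in Ioi (0 : ℝ), (Real.exp (p * k) + Real.exp (-p * k) - 2) * Real.exp k
          / (Real.exp k - 1) ^ (1 + α)) ∧
      (∫ k in Ioi (0 : ℝ), (Real.exp (p * k) + Real.exp (-p * k) - 2) * Real.exp k
          / (Real.exp k - 1) ^ (1 + α))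
        ≤ (∫ k in Ioi (0 : ℝ), k ^ 2 * (Real.exp (A * k) + 1) * Real.exp k
          / (2 * (Real.exp k - 1) ^ (1 + α))) * p ^ 2 := by
  have hI2 := aux_int_s6 hA hAα hα2
  have hr : ∀ k ∈ Ioi (0 : ℝ), 0 < (Real.exp k - 1) ^ (1 + α) := fun k hk =>
    Real.rpow_pos_of_pos (by linarith [Real.add_one_lt_exp (ne_of_gt (mem_Ioi.1 hk)), mem_Ioi.1 hk]) _
  have hle : ∀ k ∈ Ioi (0 : ℝ), k ^ 2 * (Real.exp (-A * k) + 1) * Real.exp k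
        / (2 * (Real.exp k - 1) ^ (1 + α)) ≤ k ^ 2 * (Real.exp (A * k) + 1) * Real.exp k
        / (2 * (Real.exp k - 1) ^ (1 + α)) := by
    intro k hk
    have h := hr k hk
    have hk : 0 < k := hk
    have : -A * k ≤ A * k := by nlinarith
    gcongr
  have hpos : ∀ k ∈ Ioi (0 : ℝ), 0 < k ^ 2 * (Real.exp (-A * k) + 1) * Real.exp k
        / (2 * (Real.exp k - 1) ^ (1 + α)) := by
    intro k hk
    have h := hr k hk
    have hk : 0 < k := hk
    positivity
  have hI1 : IntegrableOn
      (fun k : ℝ => k ^ 2 * (Real.exp (-A * k) + 1) * Real.exp k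
        / (2 * (Real.exp k - 1) ^ (1 + α))) (Ioi 0) volume := by
    refine hI2.mono' (Measurable.aestronglyMeasurable (by fun_prop)) ?_
    refine (ae_restrict_mem measurableSet_Ioi).mono fun k hk => ?_
    rw [Real.norm_of_nonneg (hpos k hk).le]
    exact hle k hk
  refine ⟨hI1, hI2, ?_, setIntegral_mono_on hI1 hI2 measurableSet_Ioi hle, ?_⟩
  · rw [setIntegral_pos_iff_support_of_nonneg_ae
      ((ae_restrict_mem measurableSet_Ioi).mono fun k hk => (hpos k hk).le) hI1]
    refine lt_of_lt_of_le ?_ (measure_mono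
      (subset_inter (fun k hk => Function.mem_support.2 (hpos k hk).ne') (Subset.refl _)))
    simp
  intro p hp
  have hup : ∀ k ∈ Ioi (0 : ℝ), (Real.exp (p * k) + Real.exp (-p * k) - 2) * Real.exp k
          / (Real.exp k - 1) ^ (1 + α) ≤ k ^ 2 * (Real.exp (A * k) + 1) * Real.exp k
        / (2 * (Real.exp k - 1) ^ (1 + α)) * p ^ 2 := by
    intro k hk
    have h := hr k hk
    have hk : 0 < k := hk
    have h1 := aux_upper (p * k)
    have h2 : |p * k| ≤ A * k := by
      rw [abs_mul, abs_of_pos hk]; gcongr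
    rw [neg_mul]
    calc _ ≤ ((p * k) ^ 2 * (Real.exp (A * k) + 1) / 2) * Real.exp k
          / (Real.exp k - 1) ^ (1 + α) := by
          gcongr
          refine h1.trans ?_
          gcongr
      _ = _ := by field_simp
  have hlow : ∀ k ∈ Ioi (0 : ℝ), k ^ 2 * (Real.exp (-A * k) + 1) * Real.exp k
        / (2 * (Real.exp k - 1) ^ (1 + α)) * p ^ 2
        ≤ (Real.exp (p * k) + Real.exp (-p * k) - 2) * Real.exp k
          / (Real.exp k - 1) ^ (1 + α) := by
    intro k hk
    have h := hr k hk
    have hk : 0 < k := hk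
    have h1 := aux_lower (p * k)
    have h2 : Real.exp (-A * k) ≤ 1 := Real.exp_le_one_iff.2 (by nlinarith)
    rw [neg_mul p]
    calc _ = ((p * k) ^ 2 * (Real.exp (-A * k) + 1) / 2) * Real.exp k
          / (Real.exp k - 1) ^ (1 + α) := by field_simp
      _ ≤ _ := by
          gcongr
          refine le_trans ?_ h1
          nlinarith [sq_nonneg (p * k)]
  have hIH : IntegrableOn (fun k : ℝ => (Real.exp (p * k) + Real.exp (-p * k) - 2) * Real.exp k
          / (Real.exp k - 1) ^ (1 + α)) (Ioi 0) volume := by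
    refine (hI2.mul_const (p ^ 2)).mono' (Measurable.aestronglyMeasurable (by fun_prop)) ?_
    refine (ae_restrict_mem measurableSet_Ioi).mono fun k hk => ?_
    rw [Real.norm_of_nonneg
      ((mul_nonneg (hpos k hk).le (sq_nonneg p)).trans (hlow k hk))]
    exact hup k hk
  rw [← integral_mul_const, ← integral_mul_const]
  exact ⟨setIntegral_mono_on (hI1.mul_const _) hIH measurableSet_Ioi hlow,
    setIntegral_mono_on hIH (hI2.mul_const _) measurableSet_Ioi hup⟩
end

section
/- Let ε > 0, let 0 < C₂ ≤ C₁, let R : ℝ → ℝ be differentiable with −C₁ ≤ R'(s) ≤ −C₂ for all s ∈ ℝ, let I₀ > 0 satisfy R(I₀) = 0, and let I : [0,∞) → ℝ be differentiable with I(0) > 0 and ε I'(t) = I(t) R(I(t)) for all t ≥ 0. Then for all t ≥ 0, min(I(0), I₀) ≤ I(t) ≤ max(I(0), I₀). -/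
theorem barrier_aux (f f' : ℝ → ℝ) (M δ : ℝ) (hδ : 0 < δ)
    (hf : ∀ t : ℝ, 0 ≤ t → HasDerivAt f (f' t) t) (h0 : f 0 ≤ M)
    (h : ∀ t : ℝ, 0 ≤ t → M < f t → f t < M + δ → f' t ≤ 0) (t : ℝ) (ht : 0 ≤ t) :
    f t ≤ M := by
  apply le_of_forall_pos_lt_add
  intro e he
  have hm : 0 < min e δ := lt_min he hδ
  obtain ⟨η, hη, hηt⟩ : ∃ η : ℝ, 0 < η ∧ η * (1 + t) < min e δ := by
    refine ⟨min e δ / (2 * (1 + t)), by positivity, ?_⟩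
    have : min e δ / (2 * (1 + t)) * (1 + t) = min e δ / 2 := by
      field_simp
    linarith
  have key : f t ≤ M + η * (1 + t) := by
    refine image_le_of_deriv_right_lt_deriv_boundary' (f := f) (f' := f') (a := 0) (b := t)
      (B := fun x => M + η * (1 + x)) (B' := fun _ => η) ?_ ?_ ?_ ?_ ?_ ?_ ⟨ht, le_rfl⟩
    · exact fun x hx => (hf x hx.1).continuousAt.continuousWithinAt
    · exact fun x hx => (hf x hx.1).hasDerivWithinAt
    · skip
      linarith
    · fun_prop
    · intro x _
      have := (((hasDerivAt_id x).const_add 1).const_mul η).const_add M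
      simpa using this.hasDerivWithinAt
    · intro x hx hxe
      have h1 : 0 < η * (1 + x) := mul_pos hη (by linarith [hx.1])
      have h2 : η * (1 + x) ≤ η * (1 + t) :=
        mul_le_mul_of_nonneg_left (by linarith [hx.2]) hη.le
      have h3 := min_le_right e δ
      exact (h x hx.1 (by linarith) (by linarith)).trans_lt hη
  linarith [min_le_left e δ]

/-- Let `ε > 0`, `0 < C₂ ≤ C₁`, let `R` be differentiable with `-C₁ ≤ R' ≤ -C₂`,
let `I₀ > 0` with `R(I₀) = 0`, and let `I` solve `ε I' = I R(I)` on `[0,∞)` with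
`I(0) > 0`. Then `min(I(0), I₀) ≤ I(t) ≤ max(I(0), I₀)` for all `t ≥ 0`. -/
theorem stmt7 (ε C₁ C₂ I₀ : ℝ) (hε : 0 < ε) (hC₂ : 0 < C₂) (hC : C₂ ≤ C₁)
    (R : ℝ → ℝ) (hR : Differentiable ℝ R)
    (hR' : ∀ s : ℝ, -C₁ ≤ deriv R s ∧ deriv R s ≤ -C₂)
    (hI₀ : 0 < I₀) (hRI₀ : R I₀ = 0)
    (I : ℝ → ℝ) (hI0 : 0 < I 0)
    (hI : ∀ t : ℝ, 0 ≤ t → HasDerivAt I (I t * R (I t) / ε) t) :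
    ∀ t : ℝ, 0 ≤ t → min (I 0) I₀ ≤ I t ∧ I t ≤ max (I 0) I₀ := by
  have hanti : StrictAnti R := strictAnti_of_deriv_neg fun s => by linarith [(hR' s).2]
  intro t ht
  constructor
  · have hm : 0 < min (I 0) I₀ := lt_min hI0 hI₀
    have := barrier_aux (fun t => -I t) (fun t => -(I t * R (I t) / ε)) (-min (I 0) I₀)
      (min (I 0) I₀) hm (fun t ht => (hI t ht).neg) (neg_le_neg (min_le_left _ _)) ?_ t ht
    · simpa using this
    · intro u _ h1 h2
      have hp : 0 < I u := by linarith
      have hl : I u < I₀ := by linarith [min_le_right (I 0) I₀]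
      have hr : 0 < R (I u) := hRI₀ ▸ hanti hl
      have : 0 < I u * R (I u) / ε := by positivity
      linarith
  · refine barrier_aux I (fun t => I t * R (I t) / ε) (max (I 0) I₀) 1 one_pos hI
      (le_max_left _ _) ?_ t ht
    intro u _ h1 _
    have hl : I₀ < I u := (le_max_right _ _).trans_lt h1
    have hr : R (I u) < 0 := hRI₀ ▸ hanti hl
    exact div_nonpos_of_nonpos_of_nonneg
      (mul_nonpos_of_nonneg_of_nonpos (hI₀.trans hl).le hr.le) hε.le
end

section
/- Let ε > 0, let 0 < C₂ ≤ C₁, let R : ℝ → ℝ be differentiable with −C₁ ≤ R'(s) ≤ −C₂ for all s ∈ ℝ, let I₀ > 0 satisfy R(I₀) = 0, and let I : [0,∞) → ℝ be differentiable with 0 < I(0) ≤ I₀ and ε I'(t) = I(t) R(I(t)) for all t ≥ 0. Then for all t ≥ 0, 0 ≤ R(I(t)) ≤ R(I(0)) e^{−C₂ I(0) t / ε}. -/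
theorem aux_nonneg (f g : ℝ → ℝ) (T K : ℝ) (hT : 0 ≤ T)
    (hf : ∀ s ∈ Set.Icc 0 T, HasDerivAt f (g s * f s) s)
    (hg : ∀ s ∈ Set.Icc 0 T, g s ≤ K) (h0 : 0 ≤ f 0) : 0 ≤ f T := by
  by_contra hneg
  push Not at hneg
  have hc : ContinuousOn f (Set.Icc 0 T) := fun s hs => (hf s hs).continuousAt.continuousWithinAt
  obtain ⟨s, hs, hs0⟩ := intermediate_value_Icc' hT hc ⟨hneg.le, h0⟩
  have hd : ∀ u ∈ Set.Icc 0 T, HasDerivAt (fun u => f u ^ 2 * Real.exp (-(2 * K) * u))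
      (2 * (g u - K) * (f u ^ 2 * Real.exp (-(2 * K) * u))) u := by
    intro u hu
    have h1 := (hf u hu).pow 2
    have h2 := ((hasDerivAt_id u).const_mul (-(2 * K))).exp
    refine (h1.mul h2).congr_deriv ?_
    simp
    ring
  have hanti : AntitoneOn (fun u => f u ^ 2 * Real.exp (-(2 * K) * u)) (Set.Icc 0 T) := by
    apply antitoneOn_of_deriv_nonpos (convex_Icc 0 T)
    · exact fun u hu => (hd u hu).continuousAt.continuousWithinAt
    · exact fun u hu => (hd u (interior_subset hu)).differentiableAt.differentiableWithinAt
    · intro u hu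
      have hu := interior_subset hu
      rw [(hd u hu).deriv]
      have := hg u hu
      exact mul_nonpos_of_nonpos_of_nonneg (by linarith) (by positivity)
  have h := hanti hs ⟨hT, le_rfl⟩ hs.2
  simp only [hs0] at h
  have : 0 < f T ^ 2 * Real.exp (-(2 * K) * T) :=
    mul_pos (by nlinarith) (Real.exp_pos _)
  linarith

/-- Let `ε > 0`, `0 < C₂ ≤ C₁`, let `R` be differentiable with `-C₁ ≤ R' ≤ -C₂`,
let `I₀ > 0` with `R(I₀) = 0`, and let `I` solve `ε I' = I R(I)` on `[0,∞)` with
`0 < I(0) ≤ I₀`. Then `0 ≤ R(I(t)) ≤ R(I(0)) e^{-C₂ I(0) t/ε}` for all `t ≥ 0`. -/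
theorem stmt8 (ε C₁ C₂ I₀ : ℝ) (hε : 0 < ε) (hC₂ : 0 < C₂) (hC : C₂ ≤ C₁)
    (R : ℝ → ℝ) (hR : Differentiable ℝ R)
    (hR' : ∀ s : ℝ, -C₁ ≤ deriv R s ∧ deriv R s ≤ -C₂)
    (hI₀ : 0 < I₀) (hRI₀ : R I₀ = 0)
    (I : ℝ → ℝ) (hI0 : 0 < I 0) (hI0' : I 0 ≤ I₀)
    (hI : ∀ t : ℝ, 0 ≤ t → HasDerivAt I (I t * R (I t) / ε) t) :
    ∀ t : ℝ, 0 ≤ t →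
      0 ≤ R (I t) ∧ R (I t) ≤ R (I 0) * Real.exp (-C₂ * I 0 * t / ε) := by
  have hRanti : Antitone R := antitone_of_deriv_nonpos hR (fun s => by linarith [(hR' s).2])
  have hJ : ∀ t : ℝ, 0 ≤ t → HasDerivAt (fun t => R (I t))
      (deriv R (I t) * I t / ε * R (I t)) t := by
    intro t ht
    refine ((hR (I t)).hasDerivAt.comp t (hI t ht)).congr_deriv ?_
    ring
  have hcI : ∀ T : ℝ, ContinuousOn I (Set.Icc 0 T) :=
    fun T s hs => (hI s hs.1).continuousAt.continuousWithinAt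
  have hR0 : 0 ≤ R (I 0) := hRI₀.symm.le.trans (hRanti hI0')
  have hJ0 : ∀ t : ℝ, 0 ≤ t → 0 ≤ R (I t) := by
    intro T hT
    obtain ⟨M, hM⟩ := isCompact_Icc.exists_bound_of_continuousOn (hcI T)
    refine aux_nonneg (fun t => R (I t)) (fun t => deriv R (I t) * I t / ε) T (C₁ * M / ε) hT
      (fun s hs => hJ s hs.1) ?_ hR0
    intro s hs
    have h1 := hM s hs
    rw [Real.norm_eq_abs] at h1
    have h2 : |deriv R (I s)| ≤ C₁ := abs_le.2 ⟨(hR' _).1, by linarith [(hR' (I s)).2]⟩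
    have h3 : deriv R (I s) * I s ≤ C₁ * M :=
      (le_abs_self _).trans (by rw [abs_mul]; exact mul_le_mul h2 h1 (abs_nonneg _) (by linarith))
    exact div_le_div_of_nonneg_right h3 hε.le
  have hIn : ∀ t : ℝ, 0 ≤ t → 0 ≤ I t := by
    intro T hT
    have hc : ContinuousOn (fun t => R (I t) / ε) (Set.Icc 0 T) :=
      fun s hs => ((hJ s hs.1).continuousAt.div_const ε).continuousWithinAt
    obtain ⟨M, hM⟩ := isCompact_Icc.exists_bound_of_continuousOn hc
    refine aux_nonneg I (fun t => R (I t) / ε) T M hT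
      (fun s hs => (hI s hs.1).congr_deriv (by ring)) ?_ hI0.le
    exact fun s hs => (le_abs_self _).trans (hM s hs)
  have hmono : MonotoneOn I (Set.Ici 0) := by
    apply monotoneOn_of_deriv_nonneg (convex_Ici 0)
    · exact fun u hu => (hI u hu).continuousAt.continuousWithinAt
    · exact fun u hu => (hI u (interior_subset hu)).differentiableAt.differentiableWithinAt
    · intro u hu
      have hu : (0 : ℝ) ≤ u := interior_subset hu
      rw [(hI u hu).deriv]
      exact div_nonneg (mul_nonneg (hIn u hu) (hJ0 u hu)) hε.le
  have hd : ∀ u : ℝ, 0 ≤ u → HasDerivAt (fun u => R (I u) * Real.exp (C₂ * I 0 / ε * u))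
      ((deriv R (I u) * I u + C₂ * I 0) / ε * (R (I u) * Real.exp (C₂ * I 0 / ε * u))) u := by
    intro u hu
    have h2 := ((hasDerivAt_id u).const_mul (C₂ * I 0 / ε)).exp
    refine ((hJ u hu).mul h2).congr_deriv ?_
    simp
    ring
  have hanti : AntitoneOn (fun u => R (I u) * Real.exp (C₂ * I 0 / ε * u)) (Set.Ici 0) := by
    apply antitoneOn_of_deriv_nonpos (convex_Ici 0)
    · exact fun u hu => (hd u hu).continuousAt.continuousWithinAt
    · exact fun u hu => (hd u (interior_subset hu)).differentiableAt.differentiableWithinAt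
    · intro u hu
      have hu : (0 : ℝ) ≤ u := interior_subset hu
      rw [(hd u hu).deriv]
      have h1 : I 0 ≤ I u := hmono Set.self_mem_Ici hu hu
      have h2 : deriv R (I u) * I u + C₂ * I 0 ≤ 0 := by
        nlinarith [mul_le_mul_of_nonneg_right (hR' (I u)).2 (hIn u hu)]
      exact mul_nonpos_of_nonpos_of_nonneg (div_nonpos_of_nonpos_of_nonneg h2 hε.le)
        (mul_nonneg (hJ0 u hu) (Real.exp_pos _).le)
  intro t ht
  refine ⟨hJ0 t ht, ?_⟩
  have h := hanti Set.self_mem_Ici ht ht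
  simp only [mul_zero, Real.exp_zero, mul_one] at h
  have he : -C₂ * I 0 * t / ε = -(C₂ * I 0 / ε * t) := by ring
  rw [he, Real.exp_neg, ← div_eq_mul_inv, le_div_iff₀ (Real.exp_pos _)]
  exact h
end

section
/- Let ε > 0, let 0 < C₂ ≤ C₁, let R : ℝ → ℝ be differentiable with −C₁ ≤ R'(s) ≤ −C₂ for all s ∈ ℝ, let I₀ > 0 satisfy R(I₀) = 0, and let I : [0,∞) → ℝ be differentiable with I(0) > 0 and ε I'(t) = I(t) R(I(t)) for all t ≥ 0. Then for all t ≥ 0, I(t) = I(0) exp((1/ε) ∫₀ᵗ R(I(s)) ds), and, setting m = min(I(0), I₀) and M = max(I(0), I₀), one has ε log(m/M) ≤ ∫₀ᵗ R(I(s)) ds ≤ ε log(M/m). -/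
/-- Let `ε > 0`, `0 < C₂ ≤ C₁`, let `R` be differentiable with `-C₁ ≤ R' ≤ -C₂`,
let `I₀ > 0` with `R(I₀) = 0`, and let `I` solve `ε I' = I R(I)` on `[0,∞)` with
`I(0) > 0`. Then `I(t) = I(0) exp((1/ε) ∫₀ᵗ R(I(s)) ds)` and, with
`m = min(I(0),I₀)` and `M = max(I(0),I₀)`,
`ε log(m/M) ≤ ∫₀ᵗ R(I(s)) ds ≤ ε log(M/m)` for all `t ≥ 0`. -/
theorem stmt9 (ε C₁ C₂ I₀ : ℝ) (hε : 0 < ε) (hC₂ : 0 < C₂) (hC : C₂ ≤ C₁)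
    (R : ℝ → ℝ) (hR : Differentiable ℝ R)
    (hR' : ∀ s : ℝ, -C₁ ≤ deriv R s ∧ deriv R s ≤ -C₂)
    (hI₀ : 0 < I₀) (hRI₀ : R I₀ = 0)
    (I : ℝ → ℝ) (hI0 : 0 < I 0)
    (hI : ∀ t : ℝ, 0 ≤ t → HasDerivAt I (I t * R (I t) / ε) t) :
    ∀ t : ℝ, 0 ≤ t →
      I t = I 0 * Real.exp ((1 / ε) * ∫ s in (0 : ℝ)..t, R (I s)) ∧
      ε * Real.log (min (I 0) I₀ / max (I 0) I₀) ≤ (∫ s in (0 : ℝ)..t, R (I s)) ∧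
      (∫ s in (0 : ℝ)..t, R (I s)) ≤ ε * Real.log (max (I 0) I₀ / min (I 0) I₀) := by
  have hanti : StrictAnti R := strictAnti_of_deriv_neg (fun s => by linarith [(hR' s).2])
  have hJc : Continuous (fun s : ℝ => I (max s 0)) := by
    rw [continuous_iff_continuousAt]
    intro s
    exact ContinuousAt.comp (f := fun s : ℝ => max s 0) (g := I)
      (hI (max s 0) (le_max_right _ _)).continuousAt
      (by fun_prop)
  have hRJ : Continuous (fun s : ℝ => R (I (max s 0))) := hR.continuous.comp hJc
  have hFd : ∀ s : ℝ, HasDerivAt (fun u : ℝ => ∫ x in (0 : ℝ)..u, R (I (max x 0)))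
      (R (I (max s 0))) s := fun s =>
    intervalIntegral.integral_hasDerivAt_right (hRJ.intervalIntegrable _ _)
      (hRJ.stronglyMeasurableAtFilter _ _) hRJ.continuousAt
  have hFeq : ∀ t : ℝ, 0 ≤ t →
      (∫ x in (0 : ℝ)..t, R (I (max x 0))) = ∫ x in (0 : ℝ)..t, R (I x) := by
    intro t ht
    apply intervalIntegral.integral_congr
    intro x hx
    rw [Set.uIcc_of_le ht] at hx
    simp only [max_eq_left hx.1]
  have hform : ∀ t : ℝ, 0 ≤ t →
      I t = I 0 * Real.exp ((1 / ε) * ∫ s in (0 : ℝ)..t, R (I s)) := by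
    intro t ht
    have hg : ∀ s : ℝ, 0 ≤ s → HasDerivAt (fun u : ℝ => I u *
        Real.exp (-((1 / ε) * ∫ x in (0 : ℝ)..u, R (I (max x 0))))) 0 s := by
      intro s hs
      have h := (hI s hs).mul (((hFd s).const_mul (1 / ε)).neg.exp)
      rw [max_eq_left hs] at h
      refine h.congr_deriv ?_
      simp only [Pi.neg_apply]
      ring
    have h := constant_of_has_deriv_right_zero (a := 0) (b := t)
      (fun s hs => (hg s hs.1).continuousAt.continuousWithinAt)
      (fun s hs => (hg s hs.1).hasDerivWithinAt) t ⟨ht, le_rfl⟩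
    rw [hFeq t ht] at h
    simp only [intervalIntegral.integral_same, mul_zero, neg_zero, Real.exp_zero, mul_one] at h
    rw [← h, mul_assoc, ← Real.exp_add]
    simp
  have hpos : ∀ t : ℝ, 0 ≤ t → 0 < I t := by
    intro t ht
    rw [hform t ht]
    positivity
  have hup : ∀ t : ℝ, 0 ≤ t → I t ≤ max (I 0) I₀ := by
    intro t ht
    apply le_of_forall_pos_le_add
    intro δ hδ
    refine image_le_of_deriv_right_lt_deriv_boundary (a := 0) (b := t) (f := I)
      (f' := fun s => I s * R (I s) / ε) (B := fun _ => max (I 0) I₀ + δ) (B' := fun _ => 0)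
      (fun s hs => (hI s hs.1).continuousAt.continuousWithinAt)
      (fun s hs => (hI s hs.1).hasDerivWithinAt)
      (by have := le_max_left (I 0) I₀; linarith)
      (fun s => hasDerivAt_const _ _) ?_ ⟨ht, le_rfl⟩
    intro s hs he
    have h1 : R (I s) < 0 := by
      rw [← hRI₀]
      apply hanti
      have := le_max_right (I 0) I₀
      linarith
    exact div_neg_of_neg_of_pos (mul_neg_of_pos_of_neg (hpos s hs.1) h1) hε
  have hlo : ∀ t : ℝ, 0 ≤ t → min (I 0) I₀ ≤ I t := by
    intro t ht
    apply le_of_forall_pos_le_add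
    intro δ hδ
    have h := image_le_of_deriv_right_lt_deriv_boundary (a := 0) (b := t) (f := fun s => - I s)
      (f' := fun s => -(I s * R (I s) / ε)) (B := fun _ => -min (I 0) I₀ + δ) (B' := fun _ => 0)
      (fun s hs => (hI s hs.1).neg.continuousAt.continuousWithinAt)
      (fun s hs => (hI s hs.1).neg.hasDerivWithinAt)
      (by have := min_le_left (I 0) I₀; linarith)
      (fun s => hasDerivAt_const _ _) (by
        intro s hs he
        have h1 : 0 < R (I s) := by
          rw [← hRI₀]
          apply hanti
          have := min_le_right (I 0) I₀
          linarith
        have := div_pos (mul_pos (hpos s hs.1) h1) hε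
        linarith) (x := t) ⟨ht, le_rfl⟩
    linarith
  intro t ht
  have hF : (∫ s in (0 : ℝ)..t, R (I s)) = ε * Real.log (I t / I 0) := by
    have h := hform t ht
    have h2 : I t / I 0 = Real.exp ((1 / ε) * ∫ s in (0 : ℝ)..t, R (I s)) := by
      rw [div_eq_iff hI0.ne', mul_comm]
      exact h
    rw [h2, Real.log_exp]
    field_simp
  have hm : 0 < min (I 0) I₀ := lt_min hI0 hI₀
  have hM : 0 < max (I 0) I₀ := lt_max_of_lt_left hI0
  have hp := hpos t ht
  refine ⟨hform t ht, ?_, ?_⟩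
  · rw [hF]
    refine mul_le_mul_of_nonneg_left (Real.log_le_log (by positivity) ?_) hε.le
    exact div_le_div₀ hp.le (hlo t ht) hI0 (le_max_left _ _)
  · rw [hF]
    refine mul_le_mul_of_nonneg_left (Real.log_le_log (by positivity) ?_) hε.le
    exact div_le_div₀ hM.le (hup t ht) hm (min_le_left _ _)
end

section
/- Let α > 0, C_M > 1, δ > 0, and let ε > 0 satisfy ε² ≤ C_M − 1. Define f : ℝ × [0,∞) → ℝ by f(x,t) = C_M / (1 + e^{−(t(1+ε²)+δ)/ε} |x|^{(1+α)/ε}). Then for every x ∈ ℝ and t ≥ 0, the partial derivative ∂ₜ f(x,t) exists and ∂ₜ f(x,t) ≥ (f(x,t)/ε) (1 + ε² − f(x,t)). -/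
/-- Let `α > 0`, `C_M > 1`, `δ > 0`, `ε > 0` with `ε² ≤ C_M - 1`, and
`f(x,t) = C_M/(1 + e^{-(t(1+ε²)+δ)/ε} |x|^{(1+α)/ε})`. Then for every `x` and `t ≥ 0`,
`∂ₜ f(x,t)` exists and `∂ₜ f(x,t) ≥ (f(x,t)/ε)(1+ε²-f(x,t))`. -/
theorem stmt10 (α CM δ ε : ℝ) (hα : 0 < α) (hCM : 1 < CM) (hδ : 0 < δ)
    (hε : 0 < ε) (hε2 : ε ^ 2 ≤ CM - 1)
    (f : ℝ → ℝ → ℝ)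
    (hf : ∀ x t : ℝ, f x t
      = CM / (1 + Real.exp (-(t * (1 + ε ^ 2) + δ) / ε) * |x| ^ ((1 + α) / ε))) :
    ∀ x t : ℝ, 0 ≤ t →
      ∃ d : ℝ, HasDerivAt (fun s => f x s) d t ∧
        (f x t / ε) * (1 + ε ^ 2 - f x t) ≤ d := by
  intro x t _
  have hP : 0 ≤ |x| ^ ((1 + α) / ε) := Real.rpow_nonneg (abs_nonneg x) _
  simp only [hf]
  generalize |x| ^ ((1 + α) / ε) = P at hP
  have h1 : HasDerivAt (fun s : ℝ => -(s * (1 + ε ^ 2) + δ) / ε) (-(1 * (1 + ε ^ 2)) / ε) t :=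
    ((((hasDerivAt_id t).mul_const (1 + ε ^ 2)).add_const δ).neg).div_const ε
  have h2 := (h1.exp.mul_const P).const_add 1
  have hE := Real.exp_pos (-(t * (1 + ε ^ 2) + δ) / ε)
  have hpos : 0 < 1 + Real.exp (-(t * (1 + ε ^ 2) + δ) / ε) * P := by positivity
  have h3 := (hasDerivAt_const t CM).div h2 hpos.ne'
  refine ⟨_, h3, ?_⟩
  generalize Real.exp (-(t * (1 + ε ^ 2) + δ) / ε) = E at hE hpos
  rw [← sub_nonneg]
  have key : (0 * (1 + E * P) - CM * (E * (-(1 * (1 + ε ^ 2)) / ε) * P)) / (1 + E * P) ^ 2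
      - CM / (1 + E * P) / ε * (1 + ε ^ 2 - CM / (1 + E * P))
      = CM * (CM - 1 - ε ^ 2) / (ε * (1 + E * P) ^ 2) := by
    have := hpos.ne'
    field_simp
    ring
  rw [key]
  have : 0 ≤ CM - 1 - ε ^ 2 := by linarith
  positivity
end

section
/- Let 0 < α < 2. There exists a constant C > 0, depending only on α, with the following property: for all C_M > 0, δ > 0, ε > 0, t ≥ 0 and x ∈ ℝ, setting a(t) = e^{−(t(1+ε²)+δ)/ε} and f(x,t) = C_M/(1 + a(t)|x|^{(1+α)/ε}), the function h ↦ [C_M/(1 + a(t)(|x|^{1/ε}+h)^{1+α}) + C_M/(1 + a(t)| |x|^{1/ε} − h |^{1+α}) − 2 f(x,t)] / h^{1+α} is integrable on (0,∞) and |∫₀^∞ [C_M/(1 + a(t)(|x|^{1/ε}+h)^{1+α}) + C_M/(1 + a(t)| |x|^{1/ε} − h |^{1+α}) − 2 f(x,t)] h^{−1−α} dh| ≤ C e^{−α(t(1+ε²)+δ)/((1+α)ε)} f(x,t). -/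
open MeasureTheory Set

/-- weight -/
noncomputable def wgt (α u : ℝ) : ℝ := 1 + |u| ^ (1 + α)

lemma wgt_ge_one (α u : ℝ) : 1 ≤ wgt α u := by
  unfold wgt
  have := Real.rpow_nonneg (abs_nonneg u) (1 + α)
  linarith

lemma wgt_pos (α u : ℝ) : 0 < wgt α u := lt_of_lt_of_le one_pos (wgt_ge_one α u)

lemma wgt_mono {α u v : ℝ} (hα : 0 < α) (h : |u| ≤ |v|) : wgt α u ≤ wgt α v := by
  unfold wgt
  have := Real.rpow_le_rpow (abs_nonneg u) h (by linarith : 0 ≤ 1 + α)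
  linarith

lemma add_rpow_le {α a b : ℝ} (hα0 : 0 < α) (hα2 : α < 2) (ha : 0 ≤ a) (hb : 0 ≤ b) :
    (a + b) ^ (1 + α) ≤ 4 * (a ^ (1 + α) + b ^ (1 + α)) := by
  have h1 : (a + b) ^ (1 + α) ≤ (2 : ℝ) ^ (1 + α - 1) * (a ^ (1 + α) + b ^ (1 + α)) := by
    have := NNReal.rpow_add_le_mul_rpow_add_rpow ⟨a, ha⟩ ⟨b, hb⟩ (p := 1 + α) (by linarith)
    exact_mod_cast this
  have h2 : (2 : ℝ) ^ (1 + α - 1) ≤ 4 := by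
    calc (2 : ℝ) ^ (1 + α - 1) ≤ 2 ^ (2 : ℝ) :=
          Real.rpow_le_rpow_of_exponent_le (by norm_num) (by linarith)
      _ = 4 := by norm_num
  have h3 := Real.rpow_nonneg ha (1 + α)
  have h4 := Real.rpow_nonneg hb (1 + α)
  nlinarith

lemma wgt_sub_le {α : ℝ} (hα0 : 0 < α) (hα2 : α < 2) (Y h : ℝ) :
    wgt α Y ≤ 4 * (wgt α (Y - h) + wgt α h) := by
  have h1 := add_rpow_le hα0 hα2 (abs_nonneg (Y - h)) (abs_nonneg h)
  have h2 : |Y| ^ (1 + α) ≤ (|Y - h| + |h|) ^ (1 + α) := by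
    apply Real.rpow_le_rpow (abs_nonneg _) _ (by linarith)
    calc |Y| = |(Y - h) + h| := by ring_nf
      _ ≤ _ := abs_add_le _ _
  unfold wgt
  linarith

lemma wgt_sub_le' {α : ℝ} (hα0 : 0 < α) (hα2 : α < 2) (Y h : ℝ) (hh : |h| ≤ 1) :
    wgt α Y ≤ 5 * wgt α (Y - h) := by
  have h1 := add_rpow_le hα0 hα2 (abs_nonneg (Y - h)) (abs_nonneg h)
  have h2 : |Y| ^ (1 + α) ≤ (|Y - h| + |h|) ^ (1 + α) := by
    apply Real.rpow_le_rpow (abs_nonneg _) _ (by linarith)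
    calc |Y| = |(Y - h) + h| := by ring_nf
      _ ≤ _ := abs_add_le _ _
  have h3 : |h| ^ (1 + α) ≤ 1 := Real.rpow_le_one (abs_nonneg _) hh (by linarith)
  have h4 := Real.rpow_nonneg (abs_nonneg (Y - h)) (1 + α)
  unfold wgt
  linarith

/-- first order difference -/
lemma rpow_sub_le {α u v : ℝ} (hα0 : 0 < α) (hv : 0 ≤ v) (hvu : v ≤ u) :
    u ^ (1 + α) - v ^ (1 + α) ≤ (1 + α) * (u - v) * (1 + u ^ (1 + α)) := by
  rcases eq_or_lt_of_le (hv.trans hvu) with h0 | hu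
  · have : v = 0 := by linarith
    subst this; subst h0; simp
  have hb := one_add_mul_self_le_rpow_one_add (s := v / u - 1) (p := 1 + α)
    (by have : 0 ≤ v / u := by positivity
        linarith) (by linarith)
  have e : 1 + (v / u - 1) = v / u := by ring
  rw [e, Real.div_rpow hv hu.le, le_div_iff₀ (by positivity)] at hb
  have e2 : u ^ (1 + α) = u * u ^ α := by rw [Real.rpow_add hu, Real.rpow_one]
  have e3 : (1 + (1 + α) * (v / u - 1)) * u ^ (1 + α)
      = u ^ (1 + α) - (1 + α) * (u - v) * u ^ α := by
    rw [e2]; field_simp; ring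
  rw [e3] at hb
  have h5 : u ^ α ≤ 1 + u ^ (1 + α) := by
    rcases le_total u 1 with h | h
    · have := Real.rpow_le_one hu.le h hα0.le
      have := Real.rpow_nonneg hu.le (1 + α)
      linarith
    · have := Real.rpow_le_rpow_of_exponent_le h (by linarith : α ≤ 1 + α)
      linarith
  have : (1 + α) * (u - v) * u ^ α ≤ (1 + α) * (u - v) * (1 + u ^ (1 + α)) :=
    mul_le_mul_of_nonneg_left h5 (mul_nonneg (by linarith) (by linarith))
  linarith

lemma wgt_diff {α u v : ℝ} (hα0 : 0 < α) (hvu : |v| ≤ |u|) :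
    wgt α u - wgt α v ≤ (1 + α) * (|u| - |v|) * wgt α u := by
  have := rpow_sub_le hα0 (abs_nonneg v) hvu
  unfold wgt
  linarith

lemma one_add_rpow_le {α z : ℝ} (hα0 : 0 < α) (hα2 : α < 2) (hz : -1 ≤ z) :
    (1 + z) ^ (1 + α) ≤ (1 - α / 2) * (1 + z) + α / 2 * (1 + z) ^ 3 := by
  have h0 : 0 ≤ 1 + z := by linarith
  have := Real.geom_mean_le_arith_mean2_weighted (w₁ := 1 - α / 2) (w₂ := α / 2)
    (p₁ := 1 + z) (p₂ := (1 + z) ^ 3) (by linarith) (by linarith) h0 (by positivity) (by ring)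
  refine le_trans (le_of_eq ?_) this
  rw [← Real.rpow_natCast (1 + z) 3, ← Real.rpow_mul h0, ← Real.rpow_add_of_nonneg h0]
  · congr 1; push_cast; ring
  · linarith
  · push_cast; linarith

/-- second order difference of the weight -/
lemma wgt_second {α Y h : ℝ} (hα0 : 0 < α) (hα2 : α < 2) (hY : 0 ≤ Y) (hh : 0 < h) :
    |wgt α (Y + h) + wgt α (Y - h) - 2 * wgt α Y| ≤ 16 * wgt α Y * (h ^ (1 + α) + h ^ 2) := by
  have hw := wgt_ge_one α Y
  have hhp : 0 < h ^ (1 + α) := by positivity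
  have hfin : 16 * (h ^ (1 + α) + h ^ 2) ≤ 16 * wgt α Y * (h ^ (1 + α) + h ^ 2) := by
    have : 0 ≤ h ^ (1 + α) + h ^ 2 := by positivity
    nlinarith
  rcases lt_or_ge Y h with hlt | hge
  · refine le_trans ?_ hfin
    have a1 : (Y + h) ^ (1 + α) ≤ 4 * (h ^ (1 + α) + h ^ (1 + α)) :=
      le_trans (Real.rpow_le_rpow (by linarith) (by linarith) (by linarith))
        (add_rpow_le hα0 hα2 hh.le hh.le)
    have a2 : |Y - h| ^ (1 + α) ≤ h ^ (1 + α) :=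
      Real.rpow_le_rpow (abs_nonneg _) (by rw [abs_le]; constructor <;> linarith) (by linarith)
    have a3 : Y ^ (1 + α) ≤ h ^ (1 + α) := Real.rpow_le_rpow hY hlt.le (by linarith)
    have b1 : 0 ≤ (Y + h) ^ (1 + α) := by positivity
    have b2 : 0 ≤ |Y - h| ^ (1 + α) := by positivity
    have b3 : 0 ≤ Y ^ (1 + α) := by positivity
    unfold wgt
    rw [abs_of_nonneg (by linarith : 0 ≤ Y + h), abs_of_nonneg hY, abs_le]
    have := sq_nonneg h
    constructor <;> linarith
  · have hYp : 0 < Y := lt_of_lt_of_le hh hge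
    set z := h / Y with hz
    have hz0 : 0 < z := by positivity
    have hz1 : z ≤ 1 := by rw [hz, div_le_one hYp]; exact hge
    have hzY : h = Y * z := by rw [hz]; field_simp
    have e1 : (Y + h) ^ (1 + α) = Y ^ (1 + α) * (1 + z) ^ (1 + α) := by
      rw [← Real.mul_rpow hY (by linarith), hzY]; ring_nf
    have e2 : (Y - h) ^ (1 + α) = Y ^ (1 + α) * (1 + -z) ^ (1 + α) := by
      rw [← Real.mul_rpow hY (by linarith), hzY]; ring_nf
    have u1 := one_add_rpow_le (z := z) hα0 hα2 (by linarith)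
    have u2 := one_add_rpow_le (z := -z) hα0 hα2 (by linarith)
    have l1 := one_add_mul_self_le_rpow_one_add (s := z) (p := 1 + α) (by linarith) (by linarith)
    have l2 := one_add_mul_self_le_rpow_one_add (s := -z) (p := 1 + α) (by linarith) (by linarith)
    have hup : (1 + z) ^ (1 + α) + (1 + -z) ^ (1 + α) - 2 ≤ 6 * z ^ 2 := by
      nlinarith [sq_nonneg z]
    have hlo : 0 ≤ (1 + z) ^ (1 + α) + (1 + -z) ^ (1 + α) - 2 := by linarith
    have hYq : 0 < Y ^ (1 + α) := by positivity
    have eW : wgt α (Y + h) + wgt α (Y - h) - 2 * wgt α Y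
        = Y ^ (1 + α) * ((1 + z) ^ (1 + α) + (1 + -z) ^ (1 + α) - 2) := by
      unfold wgt
      rw [abs_of_nonneg (by linarith : 0 ≤ Y + h), abs_of_nonneg hY,
        abs_of_nonneg (by linarith : 0 ≤ Y - h), e1, e2]
      ring
    rw [eW, abs_of_nonneg (by positivity)]
    have s1 : Y ^ (1 + α) * ((1 + z) ^ (1 + α) + (1 + -z) ^ (1 + α) - 2)
        ≤ 6 * (Y ^ (1 + α) * z ^ 2) := by
      nlinarith
    have e3 : Y ^ (1 + α) * z ^ 2 = Y ^ (α - 1) * h ^ 2 := by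
      have : Y ^ (1 + α) = Y ^ (α - 1) * Y ^ 2 := by
        rw [← Real.rpow_natCast Y 2, ← Real.rpow_add hYp]; congr 1; push_cast; ring
      rw [this, hzY]; ring
    rw [e3] at s1
    refine s1.trans ?_
    rcases le_total α 1 with ha | ha
    · refine le_trans ?_ hfin
      have : Y ^ (α - 1) ≤ h ^ (α - 1) := Real.rpow_le_rpow_of_nonpos hh hge (by linarith)
      have e4 : h ^ (1 + α) = h ^ (α - 1) * h ^ 2 := by
        rw [← Real.rpow_natCast h 2, ← Real.rpow_add hh]; congr 1; push_cast; ring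
      have : Y ^ (α - 1) * h ^ 2 ≤ h ^ (1 + α) := by
        rw [e4]; gcongr
      have := sq_nonneg h
      linarith
    · have h5 : Y ^ (α - 1) ≤ wgt α Y := by
        unfold wgt
        rw [abs_of_pos hYp]
        rcases le_total Y 1 with h | h
        · have := Real.rpow_le_one hY h (by linarith : 0 ≤ α - 1)
          linarith
        · have := Real.rpow_le_rpow_of_exponent_le h (by linarith : α - 1 ≤ 1 + α)
          linarith
      have h6 : Y ^ (α - 1) * h ^ 2 ≤ wgt α Y * h ^ 2 := by gcongr
      have h7 : 0 < wgt α Y * h ^ 2 := by positivity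
      have h8 : 0 < wgt α Y * h ^ (1 + α) := by positivity
      linarith

/-- second difference of the profile, small step -/
lemma small_bound {α Y h : ℝ} (hα0 : 0 < α) (hα2 : α < 2) (hY : 0 ≤ Y) (hh : 0 < h)
    (hh1 : h ≤ 1) :
    |1 / wgt α (Y + h) + 1 / wgt α (Y - h) - 2 * (1 / wgt α Y)|
      ≤ 1 / wgt α Y * (106 * (h ^ (1 + α) + h ^ 2)) := by
  have p0 := wgt_pos α Y
  have pp := wgt_pos α (Y + h)
  have pm := wgt_pos α (Y - h)
  have hD := wgt_second hα0 hα2 hY hh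
  have h5 := wgt_sub_le' hα0 hα2 Y h (by rw [abs_of_pos hh]; exact hh1)
  have m0p : wgt α Y ≤ wgt α (Y + h) := by
    apply wgt_mono hα0; rw [abs_of_nonneg hY, abs_of_nonneg (by linarith)]; linarith
  have am : |Y - h| ≤ Y + h := by rw [abs_le]; constructor <;> linarith
  have am2 : Y - h ≤ |Y - h| := le_abs_self _
  have am3 : h - Y ≤ |Y - h| := by rw [abs_sub_comm]; exact le_abs_self _
  have am4 : |Y - h| ≤ |Y| + h := by rw [abs_of_nonneg hY]; linarith
  have mmp : wgt α (Y - h) ≤ wgt α (Y + h) := by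
    apply wgt_mono hα0; rw [abs_of_nonneg (by linarith : 0 ≤ Y + h)]; exact am
  have d1 : wgt α (Y + h) - wgt α (Y - h) ≤ 6 * h * wgt α (Y + h) := by
    have := wgt_diff (u := Y + h) (v := Y - h) hα0
      (by rw [abs_of_nonneg (by linarith : 0 ≤ Y + h)]; exact am)
    rw [abs_of_nonneg (by linarith : 0 ≤ Y + h)] at this
    refine this.trans ?_
    apply mul_le_mul_of_nonneg_right _ pp.le
    nlinarith
  have d2 : |wgt α Y - wgt α (Y - h)| ≤ 15 * h * wgt α (Y - h) := by
    rcases le_total |Y - h| |Y| with hc | hc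
    · have := wgt_diff hα0 hc
      rw [abs_of_nonneg (by linarith [wgt_mono hα0 hc])]
      refine this.trans ?_
      have k1 : (1 + α) * (|Y| - |Y - h|) ≤ 3 * h := by
        rw [abs_of_nonneg hY] at hc ⊢
        nlinarith
      calc _ ≤ 3 * h * wgt α Y := mul_le_mul_of_nonneg_right k1 p0.le
        _ ≤ 3 * h * (5 * wgt α (Y - h)) := by gcongr
        _ = _ := by ring
    · have := wgt_diff hα0 hc
      rw [abs_of_nonpos (by linarith [wgt_mono hα0 hc]), neg_sub]
      refine this.trans ?_
      apply mul_le_mul_of_nonneg_right _ pm.le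
      nlinarith
  have key : 1 / wgt α (Y + h) + 1 / wgt α (Y - h) - 2 * (1 / wgt α Y)
      = -(wgt α (Y + h) + wgt α (Y - h) - 2 * wgt α Y) / (wgt α Y * wgt α (Y + h))
        + (wgt α Y - wgt α (Y - h)) * (wgt α (Y + h) - wgt α (Y - h))
          / (wgt α Y * wgt α (Y + h) * wgt α (Y - h)) := by
    field_simp; ring
  rw [key]
  refine (abs_add_le _ _).trans ?_
  have hhp : 0 < h ^ (1 + α) := by positivity
  have t1 : |-(wgt α (Y + h) + wgt α (Y - h) - 2 * wgt α Y) / (wgt α Y * wgt α (Y + h))|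
      ≤ 1 / wgt α Y * (16 * (h ^ (1 + α) + h ^ 2)) := by
    rw [abs_div, abs_neg, abs_of_pos (by positivity : 0 < wgt α Y * wgt α (Y + h)),
      div_le_iff₀ (by positivity)]
    refine hD.trans ?_
    have : 1 / wgt α Y * (16 * (h ^ (1 + α) + h ^ 2)) * (wgt α Y * wgt α (Y + h))
      = 16 * wgt α (Y + h) * (h ^ (1 + α) + h ^ 2) := by field_simp
    rw [this]
    gcongr
  have t2 : |(wgt α Y - wgt α (Y - h)) * (wgt α (Y + h) - wgt α (Y - h))
          / (wgt α Y * wgt α (Y + h) * wgt α (Y - h))| ≤ 1 / wgt α Y * (90 * h ^ 2) := by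
    rw [abs_div, abs_mul, abs_of_pos (by positivity : 0 < wgt α Y * wgt α (Y + h) * wgt α (Y - h)),
      div_le_iff₀ (by positivity), abs_of_nonneg (by linarith : 0 ≤ wgt α (Y + h) - wgt α (Y - h))]
    calc _ ≤ (15 * h * wgt α (Y - h)) * (6 * h * wgt α (Y + h)) := by
          apply mul_le_mul d2 d1 (by linarith) (by positivity)
      _ = _ := by field_simp; norm_num
  have t3 : 0 ≤ 1 / wgt α Y * h ^ (1 + α) := by positivity
  linarith

lemma large_bound {α Y h : ℝ} (hα0 : 0 < α) (hα2 : α < 2) (hY : 0 ≤ Y) (hh : 1 ≤ h) :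
    |1 / wgt α (Y + h) + 1 / wgt α (Y - h) - 2 * (1 / wgt α Y)| / h ^ (1 + α)
      ≤ 1 / wgt α Y * (14 * (1 / wgt α h) + 8 * (1 / wgt α (Y - h))) := by
  have p0 := wgt_pos α Y
  have pp := wgt_pos α (Y + h)
  have pm := wgt_pos α (Y - h)
  have ph := wgt_pos α h
  have hh0 : 0 < h := by linarith
  have m0p : wgt α Y ≤ wgt α (Y + h) := by
    apply wgt_mono hα0; rw [abs_of_nonneg hY, abs_of_nonneg (by linarith)]; linarith
  have h4 := wgt_sub_le hα0 hα2 Y h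
  have hq : 1 / h ^ (1 + α) ≤ 2 * (1 / wgt α h) := by
    have h1 : 1 ≤ h ^ (1 + α) := Real.one_le_rpow hh (by linarith)
    have : wgt α h ≤ 2 * h ^ (1 + α) := by
      unfold wgt; rw [abs_of_pos hh0]; linarith
    rw [div_le_iff₀ (by positivity), mul_one_div, div_mul_eq_mul_div, le_div_iff₀ ph]
    linarith
  have g1 : 1 / wgt α (Y + h) ≤ 1 / wgt α Y := one_div_le_one_div_of_le p0 m0p
  have a0 : 0 < 1 / wgt α Y := by positivity
  have ap : 0 < 1 / wgt α (Y + h) := by positivity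
  have am : 0 < 1 / wgt α (Y - h) := by positivity
  have ah : 0 < 1 / wgt α h := by positivity
  have s1 : |1 / wgt α (Y + h) + 1 / wgt α (Y - h) - 2 * (1 / wgt α Y)|
      ≤ 3 * (1 / wgt α Y) + 1 / wgt α (Y - h) := by
    rw [abs_le]; constructor <;> linarith
  have s2 : 1 / wgt α (Y - h) * (1 / wgt α h)
      ≤ 1 / wgt α Y * (4 * (1 / wgt α (Y - h) + 1 / wgt α h)) := by
    have : 1 / wgt α Y * (4 * (1 / wgt α (Y - h) + 1 / wgt α h))
      = (4 * (wgt α (Y - h) + wgt α h)) / wgt α Y * (1 / wgt α (Y - h) * (1 / wgt α h)) := by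
      field_simp; ring
    rw [this]
    apply le_mul_of_one_le_left (by positivity)
    rw [one_le_div p0]; exact h4
  rw [div_eq_mul_one_div]
  calc _ ≤ (3 * (1 / wgt α Y) + 1 / wgt α (Y - h)) * (2 * (1 / wgt α h)) := by
        apply mul_le_mul s1 hq (by positivity) (by positivity)
    _ = 6 * (1 / wgt α Y * (1 / wgt α h)) + 2 * (1 / wgt α (Y - h) * (1 / wgt α h)) := by ring
    _ ≤ _ := by linarith

lemma wgt_meas {α : ℝ} (hα0 : 0 < α) : Continuous (wgt α) := by
  unfold wgt
  exact continuous_const.add (continuous_abs.rpow_const (fun _ => Or.inr (by linarith)))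

lemma wgt_inv_integrable {α : ℝ} (hα0 : 0 < α) (hα2 : α < 2) :
    Integrable (fun u : ℝ => 1 / wgt α u) := by
  have h := integrable_one_add_norm (E := ℝ) (μ := volume) (r := 1 + α)
    (by simp; exact hα0)
  refine (h.const_mul 4).mono' ?_ ?_
  · exact (continuous_const.div (wgt_meas hα0) (fun u => (wgt_pos α u).ne')).aestronglyMeasurable
  · refine Filter.Eventually.of_forall fun u => ?_
    have p := wgt_pos α u
    rw [Real.norm_of_nonneg (by positivity), Real.norm_eq_abs, Real.rpow_neg (by positivity),
      ← div_eq_mul_inv, div_le_div_iff₀ p (by positivity)]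
    have := add_rpow_le hα0 hα2 zero_le_one (abs_nonneg u)
    rw [Real.one_rpow] at this
    unfold wgt
    linarith

noncomputable def bnd (α : ℝ) : ℝ :=
  (∫ s in Ioi (0 : ℝ), (Ioc (0 : ℝ) 1).indicator (fun s => 106 * (1 + s ^ (1 - α))) s)
    + 22 * ∫ u : ℝ, 1 / wgt α u

lemma core {α : ℝ} (hα0 : 0 < α) (hα2 : α < 2) {Y : ℝ} (hY : 0 ≤ Y) :
    IntegrableOn (fun s : ℝ =>
      (1 / wgt α (Y + s) + 1 / wgt α (Y - s) - 2 * (1 / wgt α Y)) / s ^ (1 + α)) (Ioi 0) ∧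
    |∫ s in Ioi (0 : ℝ),
      (1 / wgt α (Y + s) + 1 / wgt α (Y - s) - 2 * (1 / wgt α Y)) / s ^ (1 + α)|
      ≤ bnd α * (1 / wgt α Y) := by
  have p0 := wgt_pos α Y
  have i1 : IntegrableOn ((Ioc (0 : ℝ) 1).indicator (fun s => 106 * (1 + s ^ (1 - α))))
      (Ioi 0) := by
    apply Integrable.integrableOn
    rw [integrable_indicator_iff measurableSet_Ioc]
    apply Integrable.const_mul
    have := intervalIntegral.intervalIntegrable_rpow' (a := 0) (b := 1) (r := 1 - α) (by linarith)
    rw [intervalIntegrable_iff_integrableOn_Ioc_of_le zero_le_one] at this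
    refine Integrable.add ?_ this
    exact integrableOn_const (by simp)
  have i2 := wgt_inv_integrable hα0 hα2
  have i3 : Integrable (fun s => 1 / wgt α (Y - s)) := i2.comp_sub_left Y
  have iB : IntegrableOn (fun s => 1 / wgt α Y *
      ((Ioc (0 : ℝ) 1).indicator (fun s => 106 * (1 + s ^ (1 - α))) s +
        (14 * (1 / wgt α s) + 8 * (1 / wgt α (Y - s))))) (Ioi 0) := by
    apply Integrable.const_mul
    exact i1.add ((i2.integrableOn.const_mul 14).add (i3.integrableOn.const_mul 8))
  have hb : ∀ s ∈ Ioi (0 : ℝ),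
      ‖(1 / wgt α (Y + s) + 1 / wgt α (Y - s) - 2 * (1 / wgt α Y)) / s ^ (1 + α)‖ ≤
      1 / wgt α Y * ((Ioc (0 : ℝ) 1).indicator (fun s => 106 * (1 + s ^ (1 - α))) s +
        (14 * (1 / wgt α s) + 8 * (1 / wgt α (Y - s)))) := by
    intro s hs
    have hs : 0 < s := hs
    have q1 := wgt_pos α s
    have q2 := wgt_pos α (Y - s)
    have hsp : 0 < s ^ (1 + α) := by positivity
    rw [norm_div, Real.norm_eq_abs, Real.norm_of_nonneg hsp.le]
    rcases le_or_gt s 1 with h1 | h1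
    · rw [indicator_of_mem (show s ∈ Ioc (0 : ℝ) 1 from ⟨hs, h1⟩), div_le_iff₀ hsp]
      refine (small_bound hα0 hα2 hY hs h1).trans ?_
      have e : s ^ 2 = s ^ (1 - α) * s ^ (1 + α) := by
        rw [← Real.rpow_natCast s 2, ← Real.rpow_add hs]; congr 1; push_cast; ring
      calc _ = 1 / wgt α Y * (106 * (1 + s ^ (1 - α))) * s ^ (1 + α) := by rw [e]; ring
        _ ≤ _ := by
          gcongr
          have : 0 ≤ 14 * (1 / wgt α s) + 8 * (1 / wgt α (Y - s)) := by positivity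
          linarith
    · rw [indicator_of_notMem (fun h => absurd h.2 (not_le.2 h1)), zero_add]
      exact large_bound hα0 hα2 hY h1.le
  have hae := (ae_restrict_iff' (μ := volume) measurableSet_Ioi).2 (Filter.Eventually.of_forall hb)
  have hw := (wgt_meas hα0).measurable
  constructor
  · refine Integrable.mono' iB ?_ hae
    apply Measurable.aestronglyMeasurable
    have m1 : Measurable fun s => wgt α (Y + s) := hw.comp (measurable_const.add measurable_id)
    have m2 : Measurable fun s => wgt α (Y - s) := hw.comp (measurable_const.sub measurable_id)
    fun_prop
  · have := norm_integral_le_of_norm_le iB hae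
    rw [Real.norm_eq_abs] at this
    refine this.trans ?_
    rw [integral_const_mul, mul_comm]
    gcongr
    have i4 : IntegrableOn (fun s => 14 * (1 / wgt α s) + 8 * (1 / wgt α (Y - s))) (Ioi 0) :=
      (i2.integrableOn.const_mul 14).add (i3.integrableOn.const_mul 8)
    rw [integral_add i1 i4,
      integral_add (i2.integrableOn.const_mul 14) (i3.integrableOn.const_mul 8),
      integral_const_mul, integral_const_mul]
    have k1 : ∫ s in Ioi (0 : ℝ), 1 / wgt α s ≤ ∫ u : ℝ, 1 / wgt α u :=
      setIntegral_le_integral i2 (Filter.Eventually.of_forall fun u => by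
        have := wgt_pos α u
        show 0 ≤ 1 / wgt α u
        positivity)
    have k2 : ∫ s in Ioi (0 : ℝ), 1 / wgt α (Y - s) ≤ ∫ u : ℝ, 1 / wgt α u := by
      rw [← integral_sub_left_eq_self (fun u => 1 / wgt α u) volume Y]
      exact setIntegral_le_integral i3 (Filter.Eventually.of_forall fun u => by
        have := wgt_pos α (Y - u)
        show 0 ≤ 1 / wgt α (Y - u)
        positivity)
    unfold bnd
    linarith


/-- For `0 < α < 2` there is `C > 0` depending only on `α` such that for all `C_M > 0`,
`δ > 0`, `ε > 0`, `t ≥ 0` and `x ∈ ℝ`, with `a(t) = e^{-(t(1+ε²)+δ)/ε}` and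
`f(x,t) = C_M/(1 + a(t)|x|^{(1+α)/ε})`, the integrand of the rescaled fractional
Laplacian applied to `f` is integrable on `(0,∞)` and
`|Δ_ε^{α/2} f(x,t)| ≤ C e^{-α(t(1+ε²)+δ)/((1+α)ε)} f(x,t)`. -/
theorem stmt11 (α : ℝ) (hα0 : 0 < α) (hα2 : α < 2) :
    ∃ C > 0, ∀ CM δ ε t x : ℝ, 0 < CM → 0 < δ → 0 < ε → 0 ≤ t →
      IntegrableOn
        (fun h : ℝ =>
          (CM / (1 + Real.exp (-(t * (1 + ε ^ 2) + δ) / ε) * (|x| ^ (1 / ε) + h) ^ (1 + α))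
            + CM / (1 + Real.exp (-(t * (1 + ε ^ 2) + δ) / ε) * (abs (|x| ^ (1 / ε) - h)) ^ (1 + α))
            - 2 * (CM / (1 + Real.exp (-(t * (1 + ε ^ 2) + δ) / ε) * |x| ^ ((1 + α) / ε))))
          / h ^ (1 + α))
        (Ioi 0) volume ∧
      |∫ h in Ioi (0 : ℝ),
          (CM / (1 + Real.exp (-(t * (1 + ε ^ 2) + δ) / ε) * (|x| ^ (1 / ε) + h) ^ (1 + α))
            + CM / (1 + Real.exp (-(t * (1 + ε ^ 2) + δ) / ε) * (abs (|x| ^ (1 / ε) - h)) ^ (1 + α))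
            - 2 * (CM / (1 + Real.exp (-(t * (1 + ε ^ 2) + δ) / ε) * |x| ^ ((1 + α) / ε))))
          / h ^ (1 + α)|
        ≤ C * Real.exp (-α * (t * (1 + ε ^ 2) + δ) / ((1 + α) * ε))
          * (CM / (1 + Real.exp (-(t * (1 + ε ^ 2) + δ) / ε) * |x| ^ ((1 + α) / ε))) := by
  have hB : 0 ≤ bnd α := by
    have := (core hα0 hα2 le_rfl).2
    have p := wgt_pos α 0
    have h1 := (abs_nonneg _).trans this
    exact nonneg_of_mul_nonneg_left h1 (by positivity)
  refine ⟨bnd α + 1, by linarith, ?_⟩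
  intro CM δ ε t x hCM hδ hε ht
  set T := t * (1 + ε ^ 2) + δ with hT
  set y := |x| ^ (1 / ε) with hy
  have hy0 : 0 ≤ y := by positivity
  have hxy : |x| ^ ((1 + α) / ε) = y ^ (1 + α) := by
    rw [hy, ← Real.rpow_mul (abs_nonneg x)]; congr 1; ring
  set b := Real.exp (-T / ((1 + α) * ε)) with hb
  have hb0 : 0 < b := Real.exp_pos _
  have hba : Real.exp (-T / ε) = b ^ (1 + α) := by
    rw [hb, ← Real.exp_mul]; congr 1; field_simp
  have hbα : Real.exp (-α * T / ((1 + α) * ε)) = b ^ α := by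
    rw [hb, ← Real.exp_mul]; congr 1; field_simp
  have hbq : b ^ (1 + α) = b * b ^ α := by rw [Real.rpow_add hb0, Real.rpow_one]
  have hw : ∀ u : ℝ, 0 ≤ u → ∀ v, |v| = b * u → 1 + b ^ (1 + α) * u ^ (1 + α) = wgt α v := by
    intro u hu v hv
    unfold wgt
    rw [hv, Real.mul_rpow hb0.le hu]
  rw [hxy, hba, hbα]
  have hY : 0 ≤ b * y := by positivity
  obtain ⟨c1, c2⟩ := core hα0 hα2 hY
  set G : ℝ → ℝ := fun s =>
      (1 / wgt α (b * y + s) + 1 / wgt α (b * y - s) - 2 * (1 / wgt α (b * y))) / s ^ (1 + α)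
    with hG
  have hEq : ∀ h ∈ Ioi (0 : ℝ),
      (CM / (1 + b ^ (1 + α) * (y + h) ^ (1 + α))
            + CM / (1 + b ^ (1 + α) * (abs (y - h)) ^ (1 + α))
            - 2 * (CM / (1 + b ^ (1 + α) * y ^ (1 + α)))) / h ^ (1 + α)
        = CM * b ^ (1 + α) * G (b * h) := by
    intro h hh
    have hh : 0 < h := hh
    rw [hw (y + h) (by linarith) (b * y + b * h)
        (by rw [abs_of_nonneg (by positivity)]; ring),
      hw (|y - h|) (abs_nonneg _) (b * y - b * h)
        (by rw [← mul_sub, abs_mul, abs_of_pos hb0]),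
      hw y hy0 (b * y) (by rw [abs_of_nonneg hY]), hG]
    simp only
    rw [Real.mul_rpow hb0.le hh.le]
    have : 0 < b ^ (1 + α) := by positivity
    have : 0 < h ^ (1 + α) := by positivity
    have := wgt_pos α (b * y)
    have := wgt_pos α (b * y + b * h)
    have := wgt_pos α (b * y - b * h)
    field_simp
  rw [hw y hy0 (b * y) (by rw [abs_of_nonneg hY])] at hEq ⊢
  constructor
  · rw [integrableOn_congr_fun hEq measurableSet_Ioi]
    apply Integrable.const_mul
    have := (integrableOn_Ioi_comp_mul_left_iff G 0 hb0).2 (by simpa using c1)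
    exact this
  · rw [setIntegral_congr_fun measurableSet_Ioi hEq, integral_const_mul,
      integral_comp_mul_left_Ioi G 0 hb0, mul_zero, smul_eq_mul, hbq]
    have e : CM * (b * b ^ α) * (b⁻¹ * ∫ s in Ioi (0 : ℝ), G s)
        = CM * b ^ α * ∫ s in Ioi (0 : ℝ), G s := by field_simp
    rw [e, abs_mul, abs_of_pos (by positivity)]
    have p := wgt_pos α (b * y)
    calc _ ≤ CM * b ^ α * (bnd α * (1 / wgt α (b * y))) := by gcongr
      _ ≤ CM * b ^ α * ((bnd α + 1) * (1 / wgt α (b * y))) := by gcongr; linarith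
      _ = _ := by ring
end

section
/- Let 0 < A < α < 2. There exist ε₀ > 0 and C > 0 such that for every ε ∈ (0, ε₀] and every x ∈ ℝ, the function k ↦ [((x²+1)/((x+e^{εk}−1)²+1))^{A/(2ε)} + ((x²+1)/((x−e^{εk}+1)²+1))^{A/(2ε)} − 2] e^k / (e^k−1)^{1+α} is integrable on (0,∞) and |∫₀^∞ [((x²+1)/((x+e^{εk}−1)²+1))^{A/(2ε)} + ((x²+1)/((x−e^{εk}+1)²+1))^{A/(2ε)} − 2] e^k (e^k−1)^{−1−α} dk| ≤ C. -/
open MeasureTheory Set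

/-- Ratio bound. -/
lemma ratio_le (x y h : ℝ) (hh : 0 ≤ h) (hy : |y - x| = h) :
    (x ^ 2 + 1) / (y ^ 2 + 1) ≤ (1 + h) ^ 2 := by
  rw [div_le_iff₀ (by positivity)]
  have e : h ^ 2 = (y - x) ^ 2 := by rw [← hy, sq_abs]
  have : x = y + h ∨ x = y - h := by
    rcases abs_cases (y - x) with ⟨h1, _⟩ | ⟨h1, _⟩
    · right; linarith
    · left; linarith
  have k1 : 0 ≤ h * (y - 1) ^ 2 := by positivity
  have k2 : 0 ≤ h * (y + 1) ^ 2 := by positivity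
  have k3 : 0 ≤ h ^ 2 * y ^ 2 := by positivity
  rcases this with rfl | rfl <;> nlinarith

lemma log_ratio (x y h : ℝ) (hh : 0 ≤ h) (hy : |y - x| = h) :
    |Real.log ((x ^ 2 + 1) / (y ^ 2 + 1))| ≤ 2 * Real.log (1 + h) := by
  have h1 := ratio_le x y h hh hy
  have h2 := ratio_le y x h hh (by rw [abs_sub_comm]; exact hy)
  have e : 2 * Real.log (1 + h) = Real.log ((1 + h) ^ 2) := by
    rw [Real.log_pow]; norm_num
  rw [e, abs_le]
  constructor
  · have := Real.log_le_log (by positivity) h2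
    rw [← inv_div, Real.log_inv] at this
    linarith
  · exact Real.log_le_log (by positivity) h1

lemma log_sum (x h : ℝ) (hh : 0 ≤ h) :
    |Real.log ((x ^ 2 + 1) / ((x + h) ^ 2 + 1)) + Real.log ((x ^ 2 + 1) / ((x - h) ^ 2 + 1))|
      ≤ 4 * h ^ 2 * (1 + h) ^ 4 := by
  have hp := ratio_le x (x + h) h hh (by simp [abs_of_nonneg hh])
  have hm := ratio_le x (x - h) h hh (by simp [abs_of_nonneg hh])
  set P := (x ^ 2 + 1) / ((x + h) ^ 2 + 1) with hP
  set M := (x ^ 2 + 1) / ((x - h) ^ 2 + 1) with hM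
  have P0 : 0 < P := by positivity
  have M0 : 0 < M := by positivity
  rw [← Real.log_mul P0.ne' M0.ne']
  have hPM : P * M ≤ (1 + h) ^ 4 := by
    calc P * M ≤ (1 + h) ^ 2 * (1 + h) ^ 2 := by gcongr
      _ = _ := by ring
  have y1 : 1 ≤ x ^ 2 + 1 := by nlinarith [sq_nonneg x]
  have q0 : 0 ≤ 1 / (x ^ 2 + 1) := by positivity
  have q1 : 1 / (x ^ 2 + 1) ≤ 1 := by rw [div_le_one (by positivity)]; exact y1
  have r0 : 0 ≤ x ^ 2 / (x ^ 2 + 1) := by positivity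
  have r1 : x ^ 2 / (x ^ 2 + 1) ≤ 1 := by rw [div_le_one (by positivity)]; linarith
  set q := 1 / (x ^ 2 + 1) with hq
  set r := x ^ 2 / (x ^ 2 + 1) with hr
  have key : (P * M)⁻¹ = 1 + 2 * h ^ 2 * q + h ^ 4 * q ^ 2 - 4 * h ^ 2 * (q * r) := by
    rw [hP, hM, hq, hr]; field_simp; ring
  have qr0 : 0 ≤ q * r := by positivity
  have qr1 : q * r ≤ 1 := by nlinarith
  have qq1 : q ^ 2 ≤ 1 := by nlinarith
  have H1 : 1 ≤ (1 + h) ^ 4 := one_le_pow₀ (by linarith)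
  have H2 : 1 + h ^ 2 ≤ (1 + h) ^ 4 := by
    have : 0 ≤ h ^ 3 := by positivity
    have : 0 ≤ h ^ 4 := by positivity
    nlinarith
  have a2 : 0 ≤ h ^ 2 := by positivity
  have a4 : 0 ≤ h ^ 4 := by positivity
  rw [abs_le]
  constructor
  · have := Real.log_le_sub_one_of_pos (x := (P * M)⁻¹) (by positivity)
    rw [Real.log_inv] at this
    rw [key] at this
    have b1 : h ^ 2 * q ≤ h ^ 2 := by nlinarith
    have b2 : h ^ 4 * q ^ 2 ≤ h ^ 4 := by nlinarith
    have b3 : 0 ≤ h ^ 2 * (q * r) := by positivity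
    have b4 : h ^ 2 * (1 + h ^ 2) ≤ h ^ 2 * (1 + h) ^ 4 := by gcongr
    nlinarith
  · have := Real.log_le_sub_one_of_pos (x := P * M) (by positivity)
    have PM0 : 0 < P * M := by positivity
    have e : P * M - 1 = P * M * (1 - (P * M)⁻¹) := by field_simp
    have b : 1 - (P * M)⁻¹ ≤ 4 * h ^ 2 := by
      rw [key]
      have b3 : h ^ 2 * (q * r) ≤ h ^ 2 := by nlinarith
      have : 0 ≤ h ^ 2 * q := by positivity
      have : 0 ≤ h ^ 4 * q ^ 2 := by positivity
      linarith
    calc _ ≤ P * M - 1 := this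
      _ = P * M * (1 - (P * M)⁻¹) := e
      _ ≤ P * M * (4 * h ^ 2) := by gcongr
      _ ≤ (1 + h) ^ 4 * (4 * h ^ 2) := by gcongr
      _ = _ := by ring

lemma sub_one_le (s : ℝ) : Real.exp s - 1 ≤ s * Real.exp s := by
  have := Real.add_one_le_exp (-s)
  have e : Real.exp (-s) * Real.exp s = 1 := by rw [← Real.exp_add]; simp
  nlinarith [Real.exp_pos s]

lemma exp_quad (u b : ℝ) (hu : |u| ≤ b) :
    0 ≤ Real.exp u - 1 - u ∧ Real.exp u - 1 - u ≤ b ^ 2 * Real.exp b := by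
  constructor
  · linarith [Real.add_one_le_exp u]
  · obtain ⟨h1, h2⟩ := abs_le.1 hu
    have hb : 0 ≤ b := (abs_nonneg u).trans hu
    have hsq : u ^ 2 ≤ b ^ 2 := sq_le_sq' h1 h2
    rcases le_total 0 u with h0 | h0
    · have A1 := sub_one_le u
      have A2 : u * (Real.exp u - 1) ≤ u * (u * Real.exp u) := by gcongr
      have A3 : u ^ 2 * Real.exp u ≤ b ^ 2 * Real.exp b := by gcongr
      nlinarith
    · have A1 := sub_one_le u
      have A2 := Real.add_one_le_exp u
      have A4 : 1 ≤ Real.exp b := Real.one_le_exp hb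
      have A3 : u ^ 2 * 1 ≤ b ^ 2 * Real.exp b := by gcongr
      nlinarith

/-- The bracket. -/
lemma bracket (A ε x k : ℝ) (hA : 0 < A) (he : 0 < ε) (he1 : ε ≤ 1) (hk : 0 < k) :
    |((x ^ 2 + 1) / ((x + Real.exp (ε * k) - 1) ^ 2 + 1)) ^ (A / (2 * ε))
      + ((x ^ 2 + 1) / ((x - Real.exp (ε * k) + 1) ^ 2 + 1)) ^ (A / (2 * ε)) - 2|
      ≤ 2 * A * Real.exp (6 * k) * k ^ 2 + 2 * (A * k) ^ 2 * Real.exp (A * k) ∧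
    |((x ^ 2 + 1) / ((x + Real.exp (ε * k) - 1) ^ 2 + 1)) ^ (A / (2 * ε))
      + ((x ^ 2 + 1) / ((x - Real.exp (ε * k) + 1) ^ 2 + 1)) ^ (A / (2 * ε)) - 2|
      ≤ 4 * Real.exp (A * k) := by
  obtain ⟨h, hh⟩ : ∃ h, h = Real.exp (ε * k) - 1 := ⟨_, rfl⟩
  have ek : 0 < ε * k := by positivity
  have h0 : 0 ≤ h := by rw [hh]; linarith [Real.add_one_le_exp (ε * k)]
  have h1 : 1 + h = Real.exp (ε * k) := by rw [hh]; ring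
  have hle : h ≤ ε * k * Real.exp (ε * k) := by rw [hh]; exact sub_one_le _
  rw [show x + Real.exp (ε * k) - 1 = x + h by rw [hh]; ring,
    show x - Real.exp (ε * k) + 1 = x - h by rw [hh]; ring]
  have lp := log_ratio x (x + h) h h0 (by simp [abs_of_nonneg h0])
  have lm := log_ratio x (x - h) h h0 (by simp [abs_of_nonneg h0])
  have ls := log_sum x h h0
  rw [h1, Real.log_exp] at lp lm
  rw [Real.rpow_def_of_pos (by positivity), Real.rpow_def_of_pos (by positivity)]
  set a := Real.log ((x ^ 2 + 1) / ((x + h) ^ 2 + 1))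
  set b := Real.log ((x ^ 2 + 1) / ((x - h) ^ 2 + 1))
  have p0 : 0 < A / (2 * ε) := by positivity
  have ub : ∀ a : ℝ, |a| ≤ 2 * (ε * k) → |a * (A / (2 * ε))| ≤ A * k := by
    intro a ha
    rw [abs_mul, abs_of_pos p0]
    calc |a| * (A / (2 * ε)) ≤ 2 * (ε * k) * (A / (2 * ε)) := by gcongr
      _ = A * k := by field_simp
  have ua := ub a lp
  have ub' := ub b lm
  have us : |a * (A / (2 * ε)) + b * (A / (2 * ε))| ≤ 2 * A * Real.exp (6 * k) * k ^ 2 := by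
    rw [← add_mul, abs_mul, abs_of_pos p0]
    calc |a + b| * (A / (2 * ε)) ≤ (4 * h ^ 2 * (1 + h) ^ 4) * (A / (2 * ε)) := by gcongr
      _ ≤ (4 * (ε * k * Real.exp (ε * k)) ^ 2 * (Real.exp (ε * k)) ^ 4) * (A / (2 * ε)) := by
        rw [h1]; gcongr
      _ = 2 * A * (Real.exp (ε * k)) ^ 6 * k ^ 2 * ε := by field_simp; ring
      _ ≤ 2 * A * (Real.exp (1 * k)) ^ 6 * k ^ 2 * 1 := by gcongr
      _ = _ := by rw [← Real.exp_nat_mul]; norm_num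
  constructor
  · obtain ⟨c1, c2⟩ := exp_quad _ _ ua
    obtain ⟨d1, d2⟩ := exp_quad _ _ ub'
    obtain ⟨s1, s2⟩ := abs_le.1 us
    have : 0 ≤ (A * k) ^ 2 * Real.exp (A * k) := by positivity
    rw [abs_le]
    constructor <;> linarith
  · have c := Real.exp_le_exp.2 (abs_le.1 ua).2
    have d := Real.exp_le_exp.2 (abs_le.1 ub').2
    have c' := Real.exp_pos (a * (A / (2 * ε)))
    have d' := Real.exp_pos (b * (A / (2 * ε)))
    have : 1 ≤ Real.exp (A * k) := Real.one_le_exp (by positivity)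
    rw [abs_le]
    constructor <;> linarith

/-- For `0 < A < α < 2` there exist `ε₀ > 0` and `C > 0` such that for all
`ε ∈ (0, ε₀]` and all `x ∈ ℝ`, the rescaled fractional-Laplacian integrand evaluated
at the profile `φ(x) = -(A/2) log(x²+1)` is integrable on `(0,∞)` and its integral
is bounded by `C` in absolute value. -/
theorem stmt12 (α A : ℝ) (hA : 0 < A) (hAα : A < α) (hα2 : α < 2) :
    ∃ ε₀ > 0, ∃ C > 0, ∀ ε : ℝ, 0 < ε → ε ≤ ε₀ → ∀ x : ℝ,
      IntegrableOn
        (fun k : ℝ =>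
          (((x ^ 2 + 1) / ((x + Real.exp (ε * k) - 1) ^ 2 + 1)) ^ (A / (2 * ε))
            + ((x ^ 2 + 1) / ((x - Real.exp (ε * k) + 1) ^ 2 + 1)) ^ (A / (2 * ε)) - 2)
          * Real.exp k / (Real.exp k - 1) ^ (1 + α))
        (Ioi 0) volume ∧
      |∫ k in Ioi (0 : ℝ),
          (((x ^ 2 + 1) / ((x + Real.exp (ε * k) - 1) ^ 2 + 1)) ^ (A / (2 * ε))
            + ((x ^ 2 + 1) / ((x - Real.exp (ε * k) + 1) ^ 2 + 1)) ^ (A / (2 * ε)) - 2)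
          * Real.exp k / (Real.exp k - 1) ^ (1 + α)| ≤ C := by
  set C₁ : ℝ := (2 * A * Real.exp 6 + 2 * A ^ 2 * Real.exp A) * Real.exp 1 with hC₁
  set C₂ : ℝ := 4 * 2 ^ (1 + α) with hC₂
  set g₁ : ℝ → ℝ := fun k => C₁ * k ^ (1 - α) with hg₁
  set g₂ : ℝ → ℝ := fun k => C₂ * Real.exp ((A - α) * k) with hg₂
  set g : ℝ → ℝ := fun k => (Ioc 0 1).indicator g₁ k + (Ioi 1).indicator g₂ k with hg
  have i₁ : Integrable ((Ioc (0:ℝ) 1).indicator g₁) := by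
    rw [integrable_indicator_iff measurableSet_Ioc]
    have := (intervalIntegral.intervalIntegrable_rpow' (a := 0) (b := 1) (r := 1 - α)
      (by linarith)).const_mul C₁
    exact (intervalIntegrable_iff_integrableOn_Ioc_of_le zero_le_one).1 this
  have i₂ : Integrable ((Ioi (1:ℝ)).indicator g₂) := by
    rw [integrable_indicator_iff measurableSet_Ioi]
    exact (integrableOn_exp_mul_Ioi (by linarith) 1).const_mul C₂
  have ig : Integrable g (volume.restrict (Ioi 0)) := (i₁.add i₂).restrict
  refine ⟨1, one_pos, |∫ k in Ioi (0:ℝ), g k| + 1, by positivity, ?_⟩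
  intro ε he he1 x
  have hb : ∀ᵐ k ∂(volume.restrict (Ioi (0:ℝ))),
      ‖(((x ^ 2 + 1) / ((x + Real.exp (ε * k) - 1) ^ 2 + 1)) ^ (A / (2 * ε))
            + ((x ^ 2 + 1) / ((x - Real.exp (ε * k) + 1) ^ 2 + 1)) ^ (A / (2 * ε)) - 2)
          * Real.exp k / (Real.exp k - 1) ^ (1 + α)‖ ≤ g k := by
    refine (ae_restrict_iff' measurableSet_Ioi).2 (Filter.Eventually.of_forall ?_)
    intro k hk
    have hk : 0 < k := hk
    obtain ⟨B1, B2⟩ := bracket A ε x k hA he he1 hk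
    have hkk : k ≤ Real.exp k - 1 := by linarith [Real.add_one_le_exp k]
    have hpos : 0 < Real.exp k - 1 := by linarith
    rw [Real.norm_eq_abs, abs_div, abs_mul, abs_of_pos (Real.exp_pos k),
      abs_of_pos (Real.rpow_pos_of_pos hpos _)]
    rcases le_or_gt k 1 with h1 | h1
    · have hgk : g k = C₁ * k ^ (1 - α) := by simp [hg, hg₁, hk, h1]
      rw [hgk]
      have hrp : k ^ (1 - α) = k ^ 2 / k ^ (1 + α) := by
        rw [show 1 - α = (2:ℕ) - (1 + α) by push_cast; ring, Real.rpow_sub hk, Real.rpow_natCast]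
      rw [hrp, ← mul_div_assoc]
      have q : 2 * A * Real.exp (6 * k) * k ^ 2 + 2 * (A * k) ^ 2 * Real.exp (A * k)
          ≤ (2 * A * Real.exp 6 + 2 * A ^ 2 * Real.exp A) * k ^ 2 := by
        have q1 : Real.exp (6 * k) ≤ Real.exp 6 := Real.exp_le_exp.2 (by linarith)
        have q2 : Real.exp (A * k) ≤ Real.exp A := Real.exp_le_exp.2 (by nlinarith)
        calc _ ≤ 2 * A * Real.exp 6 * k ^ 2 + 2 * (A * k) ^ 2 * Real.exp A := by gcongr
          _ = _ := by ring
      have num := B1.trans q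
      have e1 : Real.exp k ≤ Real.exp 1 := Real.exp_le_exp.2 h1
      have den : k ^ (1 + α) ≤ (Real.exp k - 1) ^ (1 + α) :=
        Real.rpow_le_rpow hk.le hkk (by linarith)
      have := Real.rpow_pos_of_pos hk (1 + α)
      calc _ ≤ ((2 * A * Real.exp 6 + 2 * A ^ 2 * Real.exp A) * k ^ 2) * Real.exp 1
            / k ^ (1 + α) := by gcongr
        _ = _ := by rw [hC₁]; ring
    · have hgk : g k = C₂ * Real.exp ((A - α) * k) := by simp [hg, hg₂, h1, not_le.2 h1]
      rw [hgk]
      have hden : Real.exp k / 2 ≤ Real.exp k - 1 := by linarith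
      have den : (Real.exp k / 2) ^ (1 + α) ≤ (Real.exp k - 1) ^ (1 + α) :=
        Real.rpow_le_rpow (by positivity) hden (by linarith)
      have e2 : (Real.exp k / 2) ^ (1 + α) = Real.exp (k * (1 + α)) / 2 ^ (1 + α) := by
        rw [Real.div_rpow (Real.exp_pos k).le (by norm_num), ← Real.exp_mul]
      have dpos : 0 < (Real.exp k / 2) ^ (1 + α) := by positivity
      calc _ ≤ 4 * Real.exp (A * k) * Real.exp k / (Real.exp k / 2) ^ (1 + α) := by gcongr
        _ = _ := by
          rw [e2, hC₂, show (A - α) * k = A * k + k - k * (1 + α) by ring, Real.exp_sub,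
            Real.exp_add]
          field_simp
  refine ⟨ig.mono' (Measurable.aestronglyMeasurable (by fun_prop)) hb, ?_⟩
  have := norm_integral_le_of_norm_le ig hb
  rw [Real.norm_eq_abs] at this
  linarith [le_abs_self (∫ k in Ioi (0:ℝ), g k)]
end

section
/- Let A > 0, C > 0, t > 0 and x ∈ ℝ. Then sup_{y∈ℝ} (−A log(1+|y|) − (x−y)²/(4Ct) + t) ≥ 0 if and only if |x| ≤ max_{r∈[0,1]} (2√C r t + e^{t(1−r²)/A} − 1). -/
/-- For `A > 0`, `C > 0`, `t > 0` and `x ∈ ℝ`: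
`sup_{y∈ℝ} (-A log(1+|y|) - (x-y)²/(4Ct) + t) ≥ 0` if and only if
`|x| ≤ max_{r∈[0,1]} (2√C r t + e^{t(1-r²)/A} - 1)`. -/
theorem stmt15 (A C t x : ℝ) (hA : 0 < A) (hC : 0 < C) (ht : 0 < t) :
    (0 ≤ ⨆ y : ℝ, (-A * Real.log (1 + |y|) - (x - y) ^ 2 / (4 * C * t) + t))
    ↔ |x| ≤ ⨆ r : Set.Icc (0 : ℝ) 1,
        (2 * Real.sqrt C * (r : ℝ) * t + Real.exp (t * (1 - (r : ℝ) ^ 2) / A) - 1) := by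
  have hs : 0 < Real.sqrt C := Real.sqrt_pos.mpr hC
  have hsq : Real.sqrt C ^ 2 = C := Real.sq_sqrt hC.le
  have hlog : ∀ y : ℝ, 0 ≤ Real.log (1 + |y|) := fun y =>
    Real.log_nonneg (by linarith [abs_nonneg y])
  have hgc : Continuous (fun r : Set.Icc (0 : ℝ) 1 =>
      (2 * Real.sqrt C * (r : ℝ) * t + Real.exp (t * (1 - (r : ℝ) ^ 2) / A) - 1)) := by
    fun_prop
  have hD : 0 < 4 * C * t := by positivity
  constructor
  · intro h
    have hfc : Continuous (fun y : ℝ =>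
        -A * Real.log (1 + |y|) - (x - y) ^ 2 / (4 * C * t) + t) := by
      have h1 : Continuous (fun y : ℝ => Real.log (1 + |y|)) :=
        Continuous.log (by fun_prop) (fun y => by linarith [abs_nonneg y])
      fun_prop
    obtain ⟨y, hy⟩ := hfc.exists_forall_ge' x (by
      have hR : ∀ᶠ y in Filter.cocompact ℝ,
          1 + 4 * C * t * (A * Real.log (1 + |x|)) ≤ dist y x :=
        (tendsto_dist_right_cocompact_atTop x).eventually_ge_atTop _
      filter_upwards [hR] with y hR
      rw [Real.dist_eq] at hR
      have h0 : 0 ≤ 4 * C * t * (A * Real.log (1 + |x|)) := by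
        have := hlog x
        positivity
      have h2 : 4 * C * t * (A * Real.log (1 + |x|)) ≤ (x - y) ^ 2 := by
        have : (x - y) ^ 2 = |y - x| ^ 2 := by rw [sq_abs]; ring
        rw [this]
        nlinarith
      have h3 : A * Real.log (1 + |x|) ≤ (x - y) ^ 2 / (4 * C * t) := by
        rw [le_div_iff₀ hD]; linarith
      have h4 := mul_nonneg hA.le (hlog y)
      simp only [sub_self]
      norm_num
      linarith)
    have hy0 : 0 ≤ -A * Real.log (1 + |y|) - (x - y) ^ 2 / (4 * C * t) + t :=
      h.trans (ciSup_le hy)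
    set r : ℝ := |x - y| / (2 * Real.sqrt C * t) with hr
    have hrt : 2 * Real.sqrt C * r * t = |x - y| := by rw [hr]; field_simp
    have hr2 : t * r ^ 2 = (x - y) ^ 2 / (4 * C * t) := by
      rw [hr, div_pow, sq_abs, mul_pow, mul_pow, hsq]; field_simp; norm_num
    have hr0 : 0 ≤ r := by positivity
    have hAl := mul_nonneg hA.le (hlog y)
    have hr1 : r ≤ 1 := by
      have : t * r ^ 2 ≤ t * 1 := by linarith
      have := le_of_mul_le_mul_left this ht
      nlinarith
    have hl : Real.log (1 + |y|) ≤ t * (1 - r ^ 2) / A := by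
      rw [le_div_iff₀ hA]; linarith
    have he := (Real.log_le_iff_le_exp (by linarith [abs_nonneg y])).mp hl
    have hb := le_ciSup (isCompact_range hgc).bddAbove ⟨r, hr0, hr1⟩
    simp only at hb
    have htri : |x| ≤ |x - y| + |y| := by
      simpa using abs_add_le (x - y) y
    linarith
  · intro h
    obtain ⟨⟨r, hr0, hr1⟩, -, hmax⟩ := isCompact_univ.exists_isMaxOn
      (Set.univ_nonempty (α := Set.Icc (0 : ℝ) 1)) hgc.continuousOn
    have hx := h.trans (ciSup_le (fun s => hmax (Set.mem_univ s)))
    simp only at hx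
    set Y := Real.exp (t * (1 - r ^ 2) / A) - 1 with hY
    have hr2 : r ^ 2 ≤ 1 := by nlinarith
    have hY0 : 0 ≤ Y := by
      have : 0 ≤ t * (1 - r ^ 2) / A := by
        have : 0 ≤ 1 - r ^ 2 := by linarith
        positivity
      have := Real.one_le_exp this
      linarith
    have hd : 0 ≤ 2 * Real.sqrt C * r * t := by positivity
    obtain ⟨y, hy1, hy2⟩ : ∃ y : ℝ, |y| ≤ Y ∧ |x - y| ≤ 2 * Real.sqrt C * r * t := by
      have h1 := le_abs_self x
      have h2 := neg_abs_le x
      rcases le_total x (-Y) with h3 | h3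
      · exact ⟨-Y, by rw [abs_neg, abs_of_nonneg hY0], by rw [abs_le]; constructor <;> linarith⟩
      rcases le_total x Y with h4 | h4
      · exact ⟨x, abs_le.mpr ⟨h3, h4⟩, by simpa using hd⟩
      · exact ⟨Y, by rw [abs_of_nonneg hY0], by rw [abs_le]; constructor <;> linarith⟩
    have hbdd : BddAbove (Set.range (fun y : ℝ =>
        -A * Real.log (1 + |y|) - (x - y) ^ 2 / (4 * C * t) + t)) := by
      refine ⟨t, ?_⟩
      rintro _ ⟨z, rfl⟩
      have h1 := mul_nonneg hA.le (hlog z)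
      have h2 : 0 ≤ (x - z) ^ 2 / (4 * C * t) := by positivity
      simp only
      linarith
    refine le_trans ?_ (le_ciSup hbdd y)
    have hl : Real.log (1 + |y|) ≤ t * (1 - r ^ 2) / A :=
      (Real.log_le_iff_le_exp (by linarith [abs_nonneg y])).mpr (by linarith)
    rw [le_div_iff₀ hA] at hl
    have hq : (x - y) ^ 2 / (4 * C * t) ≤ t * r ^ 2 := by
      rw [div_le_iff₀ hD, ← sq_abs]
      calc |x - y| ^ 2 ≤ (2 * Real.sqrt C * r * t) ^ 2 := by gcongr
        _ = t * r ^ 2 * (4 * Real.sqrt C ^ 2 * t) := by ring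
        _ = _ := by rw [hsq]
    linarith
end

section
/- Let A > 0, C > 0 and t > 0, and define φ : ℝ → ℝ by φ(x) = sup_{y∈ℝ} (−A log(1+|y|) − (x−y)²/(4Ct)). Then φ(0) = 0, and φ(x) < 0 for every x ≠ 0. -/
/-- For `A > 0`, `C > 0`, `t > 0`, the function
`φ(x) = sup_{y∈ℝ} (-A log(1+|y|) - (x-y)²/(4Ct))` satisfies `φ(0) = 0` and
`φ(x) < 0` for `x ≠ 0`. -/
theorem stmt16 (A C t : ℝ) (hA : 0 < A) (hC : 0 < C) (ht : 0 < t)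
    (φ : ℝ → ℝ)
    (hφ : ∀ x : ℝ, φ x = ⨆ y : ℝ, (-A * Real.log (1 + |y|) - (x - y) ^ 2 / (4 * C * t))) :
    φ 0 = 0 ∧ ∀ x : ℝ, x ≠ 0 → φ x < 0 := by
  have hlog : ∀ y : ℝ, 0 ≤ A * Real.log (1 + |y|) := fun y =>
    mul_nonneg hA.le (Real.log_nonneg (by linarith [abs_nonneg y]))
  have hq : ∀ z : ℝ, 0 ≤ z ^ 2 / (4 * C * t) := fun z => by positivity
  constructor
  · rw [hφ]
    apply le_antisymm
    · exact ciSup_le fun y => by linarith [hlog y, hq (0 - y)]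
    · refine le_ciSup_of_le ⟨0, ?_⟩ 0 (by simp)
      rintro _ ⟨y, rfl⟩
      dsimp only
      linarith [hlog y, hq (0 - y)]
  · intro x hx
    have hx' : 0 < |x| := abs_pos.mpr hx
    have h1 : 0 < A * Real.log (1 + |x| / 2) := mul_pos hA (Real.log_pos (by linarith))
    have h2 : 0 < (|x| / 2) ^ 2 / (4 * C * t) := by positivity
    rw [hφ]
    refine lt_of_le_of_lt (b := max (-(A * Real.log (1 + |x| / 2)))
      (-((|x| / 2) ^ 2 / (4 * C * t)))) (ciSup_le fun y => ?_)
      (max_lt (by linarith) (by linarith))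
    rcases le_total (|x| / 2) |y| with h | h
    · apply le_max_of_le_left
      have : A * Real.log (1 + |x| / 2) ≤ A * Real.log (1 + |y|) := by gcongr
      linarith [hq (x - y)]
    · apply le_max_of_le_right
      have h3 : |x| / 2 ≤ |x - y| := by linarith [abs_sub_abs_le_abs_sub x y]
      have : (|x| / 2) ^ 2 / (4 * C * t) ≤ (x - y) ^ 2 / (4 * C * t) := by
        rw [← sq_abs (x - y)]
        gcongr
      linarith [hlog y]
end

section
/- Let A > 0, B ∈ ℝ and I_m > 0. There exist ε₀ > 0 and A₂ > 0 such that for every ε ∈ (0, ε₀] and every continuous function u : ℝ → ℝ satisfying u(x) ≤ −(A/2) log(x²+1) + B for all x ∈ ℝ and ∫_ℝ e^{u(x)/ε} dx ≥ I_m, one has ∫_{|x| ≤ A₂} e^{u(x)/ε} dx ≥ I_m/2 and sup_{x∈ℝ} u(x) ≥ ε log(I_m/(4 A₂)). -/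
open MeasureTheory Set

/-- For `A > 0`, `B ∈ ℝ`, `I_m > 0` there exist `ε₀ > 0` and `A₂ > 0` such that for
every `ε ∈ (0,ε₀]` and every continuous `u : ℝ → ℝ` with
`u(x) ≤ -(A/2) log(x²+1) + B` and `∫ e^{u/ε} ≥ I_m`, the mass on `{|x| ≤ A₂}` is at
least `I_m/2` and `sup u ≥ ε log(I_m/(4A₂))`. -/
theorem stmt17 (A B Im : ℝ) (hA : 0 < A) (hIm : 0 < Im) :
    ∃ ε₀ > 0, ∃ A₂ > 0, ∀ ε : ℝ, 0 < ε → ε ≤ ε₀ →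
      ∀ u : ℝ → ℝ, Continuous u →
        (∀ x : ℝ, u x ≤ -(A / 2) * Real.log (x ^ 2 + 1) + B) →
        Im ≤ (∫ x : ℝ, Real.exp (u x / ε)) →
        Im / 2 ≤ (∫ x in {x : ℝ | |x| ≤ A₂}, Real.exp (u x / ε)) ∧
        ε * Real.log (Im / (4 * A₂)) ≤ ⨆ x : ℝ, u x := by
  have hg : Integrable (fun x : ℝ => (1 + x ^ 2)⁻¹) := integrable_inv_one_add_sq
  have hS : ∀ R : ℝ, MeasurableSet {x : ℝ | |x| ≤ R} := fun R =>
    measurableSet_le (by fun_prop) measurable_const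
  have htail : Filter.Tendsto (fun R : ℝ => ∫ x in {x : ℝ | |x| ≤ R}ᶜ, (1 + x ^ 2)⁻¹)
      Filter.atTop (nhds 0) := by
    have h := tendsto_setIntegral_of_antitone (μ := volume) (f := fun x : ℝ => (1 + x ^ 2)⁻¹)
      (s := fun R : ℝ => {x : ℝ | |x| ≤ R}ᶜ) (fun R => (hS R).compl)
      (fun a b hab => compl_subset_compl.mpr (fun x (hx : |x| ≤ a) => le_trans hx hab))
      ⟨0, hg.integrableOn⟩
    have h0 : (⋂ R : ℝ, {x : ℝ | |x| ≤ R}ᶜ) = ∅ := by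
      ext x
      simp only [mem_iInter, mem_compl_iff, mem_setOf_eq, mem_empty_iff_false, iff_false]
      intro h
      exact h |x| le_rfl
    rw [h0] at h
    simpa using h
  obtain ⟨R, hR1, hR2, hR3⟩ := ((htail.eventually (gt_mem_nhds (half_pos hIm))).and
    ((Filter.eventually_ge_atTop (1 : ℝ)).and
      (Filter.eventually_ge_atTop (Real.exp (4 * B / A))))).exists
  have hR0 : 0 < R := by linarith
  refine ⟨A / 4, by positivity, R, hR0, ?_⟩
  intro ε hε hεA u hu hub hI
  have hint : Integrable (fun x => Real.exp (u x / ε)) := by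
    by_contra h
    rw [integral_undef h] at hI
    linarith
  have key : ∀ x ∈ {x : ℝ | |x| ≤ R}ᶜ, Real.exp (u x / ε) ≤ (1 + x ^ 2)⁻¹ := by
    intro x hx
    have hx' : R < |x| := not_le.mp hx
    have hsq : R < x ^ 2 + 1 := by
      rw [← sq_abs]
      nlinarith
    have hpos : 0 < x ^ 2 + 1 := by positivity
    have hlog : 4 * B / A ≤ Real.log (x ^ 2 + 1) :=
      (Real.le_log_iff_exp_le hpos).mpr (by linarith)
    have hlog0 : 0 ≤ Real.log (x ^ 2 + 1) := Real.log_nonneg (by nlinarith [sq_nonneg x])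
    rw [div_le_iff₀ hA] at hlog
    have h1 : u x / ε ≤ - Real.log (x ^ 2 + 1) := by
      rw [div_le_iff₀ hε]
      nlinarith [hub x, mul_le_mul_of_nonneg_right hεA hlog0]
    calc Real.exp (u x / ε) ≤ Real.exp (- Real.log (x ^ 2 + 1)) := Real.exp_le_exp.mpr h1
      _ = (1 + x ^ 2)⁻¹ := by rw [Real.exp_neg, Real.exp_log hpos, add_comm]
  have hle := setIntegral_mono_on hint.integrableOn hg.integrableOn (hS R).compl key
  have hsplit := integral_add_compl (hS R) hint
  have hmass : Im / 2 ≤ ∫ x in {x : ℝ | |x| ≤ R}, Real.exp (u x / ε) := by linarith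
  refine ⟨hmass, ?_⟩
  have hbdd : BddAbove (range u) := by
    refine ⟨B, ?_⟩
    rintro _ ⟨x, rfl⟩
    have hlog0 : 0 ≤ Real.log (x ^ 2 + 1) := Real.log_nonneg (by nlinarith [sq_nonneg x])
    nlinarith [hub x]
  have hset : {x : ℝ | |x| ≤ R} = Icc (-R) R := by
    ext x
    simp [abs_le]
  have hup : (∫ x in {x : ℝ | |x| ≤ R}, Real.exp (u x / ε))
      ≤ 2 * R * Real.exp ((⨆ x, u x) / ε) := by
    have h := setIntegral_mono_on (μ := volume) (s := {x : ℝ | |x| ≤ R})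
      (g := fun _ => Real.exp ((⨆ x, u x) / ε)) hint.integrableOn
      (by rw [hset]; exact integrableOn_const (by simp)) (hS R)
      (fun x _ => Real.exp_le_exp.mpr (div_le_div_of_nonneg_right (le_ciSup hbdd x) hε.le))
    refine h.trans (le_of_eq ?_)
    rw [hset, setIntegral_const, Real.volume_real_Icc_of_le (by linarith), smul_eq_mul]
    ring
  have hfin : Real.log (Im / (4 * R)) ≤ (⨆ x, u x) / ε := by
    rw [Real.log_le_iff_le_exp (by positivity), div_le_iff₀ (by positivity)]
    linarith
  rw [le_div_iff₀ hε] at hfin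
  linarith
end
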